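/- arXiv:2507.03481 — 5 statements merged into one kernel-verified Lean document; each statement's English description precedes it below -/
import Mathlib

section
/- For every transmission rate t > 0 and every ε > 0 there exists n₀ such that for all n ≥ n₀ the following holds with k = ⌊tn⌋: for every admissible partition 𝒜₁, …, 𝒜ₘ of 𝒱^k with compositions Q₁, …, Qₘ ∈ 𝒫ₙ(𝒳), there exists a joint source-channel code of parameters (k, n) whose error probability satisfies p_e ≤ e^{nε} · Σ_{c=1}^{m} exp( − sup_{ρ ≥ 1} { n·E′_x(Q_c, ρ) − E_s^{(c)}(ρ, P^k) } ), where E_s^{(c)}(ρ, P^k) := (1+ρ)·log( Σ_{v ∈ 𝒜_c} P^k(v)^{1/(1+ρ)} ). -/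
open scoped Classical BigOperators

noncomputable section

/-- `P` is a probability distribution on the finite alphabet `α`. -/
def IsProbDist {α : Type} [Fintype α] (P : α → ℝ) : Prop :=
  (∀ a, 0 ≤ P a) ∧ ∑ a, P a = 1

/-- `W` is a discrete memoryless channel (a stochastic matrix). -/
def IsDMC {X Y : Type} [Fintype Y] (W : X → Y → ℝ) : Prop :=
  (∀ x y, 0 ≤ W x y) ∧ ∀ x, ∑ y, W x y = 1

/-- Product extension of a distribution: `P^k(v) = ∏ P(vᵢ)`. -/
def prodDist {α : Type} (P : α → ℝ) {k : ℕ} (v : Fin k → α) : ℝ := ∏ i, P (v i)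

/-- Product extension of a channel: `W^n(y|x) = ∏ W(y_l|x_l)`. -/
def Wn {X Y : Type} (W : X → Y → ℝ) {n : ℕ} (x : Fin n → X) (y : Fin n → Y) : ℝ :=
  ∏ l, W (x l) (y l)

/-- Shannon entropy (natural logarithm). -/
def entH {α : Type} [Fintype α] (P : α → ℝ) : ℝ := -∑ a, P a * Real.log (P a)

/-- Kullback–Leibler divergence `D(P‖Q)`. -/
def KL {α : Type} [Fintype α] (P Q : α → ℝ) : ℝ := ∑ a, P a * Real.log (P a / Q a)

/-- Empirical distribution (type) of a sequence. -/
def empDist {α : Type} [Fintype α] {k : ℕ} (v : Fin k → α) : α → ℝ :=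
  fun a => ((Finset.univ.filter fun i => v i = a).card : ℝ) / k

/-- Type class `T^k(P)`: sequences of length `k` with empirical distribution `P`. -/
def typeClass {α : Type} [Fintype α] (k : ℕ) (P : α → ℝ) : Finset (Fin k → α) :=
  Finset.univ.filter fun v => empDist v = P

/-- `P` is a type of length-`k` sequences, i.e. `P ∈ 𝒫ₖ(α)`. -/
def IsType {α : Type} [Fintype α] (k : ℕ) (P : α → ℝ) : Prop :=
  ∃ v : Fin k → α, empDist v = P

/-- Source reliability function `e(R, P_V) = min_{Q : H(Q) ≥ R} D(Q‖P_V)`. -/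
def srcRel {V : Type} [Fintype V] (PV : V → ℝ) (R : ℝ) : ℝ :=
  sInf { z | ∃ Q : V → ℝ, IsProbDist Q ∧ R ≤ entH Q ∧ z = KL Q PV }

/-- Bhattacharyya distance. -/
def dB {X Y : Type} [Fintype Y] (W : X → Y → ℝ) (x x' : X) : ℝ :=
  -Real.log (∑ y, Real.sqrt (W x y * W x' y))

/-- Mutual information of a joint distribution on `X × X`. -/
def mutualInfo {X : Type} [Fintype X] (P : X × X → ℝ) : ℝ :=
  ∑ p : X × X, P p * Real.log (P p / ((∑ x', P (p.1, x')) * (∑ x, P (x, p.2))))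

/-- Weak expurgated exponent `E'_ex(Q, R)`. -/
def Eex' {X Y : Type} [Fintype X] [Fintype Y] (W : X → Y → ℝ) (Q : X → ℝ) (R : ℝ) : ℝ :=
  sInf { z | ∃ P : X × X → ℝ, IsProbDist P ∧ (∀ x, ∑ x', P (x, x') = Q x) ∧
    mutualInfo P ≤ R ∧
    z = (∑ p : X × X, P p * dB W p.1 p.2) + mutualInfo P - R }

/-- Gallager source function `E_s(ρ, P_V)`. -/
def Es {α : Type} [Fintype α] (PV : α → ℝ) (ρ : ℝ) : ℝ :=
  (1 + ρ) * Real.log (∑ v, PV v ^ (1 / (1 + ρ)))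

/-- Dual weak expurgated function `E'_x(Q, ρ)`. -/
def Ex' {X Y : Type} [Fintype X] [Fintype Y] (W : X → Y → ℝ) (Q : X → ℝ) (ρ : ℝ) : ℝ :=
  sInf { z | ∃ Q' : X → ℝ, IsProbDist Q' ∧
    z = -ρ * ∑ x, Q x * Real.log (∑ x', Q' x' * Real.exp (-dB W x x' / ρ)) }

/-- Constant-composition expurgated dual function `E_x(Q, ρ)`. -/
def Ex {X Y : Type} [Fintype X] [Fintype Y] (W : X → Y → ℝ) (Q : X → ℝ) (ρ : ℝ) : ℝ :=
  sSup { z | ∃ a : X → ℝ,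
    z = -ρ * ∑ x, Q x * Real.log (∑ x', Q x' *
      (Real.exp (-dB W x x') * Real.exp (a x' - a x)) ^ (1 / ρ)) }

/-- Error probability of a joint source-channel code `(f, φ)`. -/
def pErr {V X Y : Type} [Fintype V] [Fintype X] [Fintype Y] (PV : V → ℝ)
    (W : X → Y → ℝ) {k n : ℕ}
    (f : (Fin k → V) → Fin n → X) (φ : (Fin n → Y) → Fin k → V) : ℝ :=
  ∑ v : Fin k → V, prodDist PV v *
    ∑ y ∈ Finset.univ.filter (fun y : Fin n → Y => φ y ≠ v), Wn W (f v) y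

/-- The set `Λ_c` of source types belonging to class `c` of the partition `cls`. -/
def classTypes {V : Type} [Fintype V] {k m : ℕ} (cls : (Fin k → V) → Fin m)
    (c : Fin m) : Finset (V → ℝ) :=
  Finset.image empDist (Finset.univ.filter fun v => cls v = c)

/-- An admissible partition of `𝒱^k`: classes are unions of source type classes, and
each class `c` carries a composition `Q_c ∈ 𝒫ₙ(𝒳)` whose type class is at least as
large as the class. -/
def AdmissiblePartition {V X : Type} [Fintype V] [Fintype X] (n : ℕ) {k m : ℕ}
    (cls : (Fin k → V) → Fin m) (Qc : Fin m → X → ℝ) : Prop :=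
  (∀ v v' : Fin k → V, empDist v = empDist v' → cls v = cls v') ∧
  (∀ c, IsType n (Qc c)) ∧
  (∀ c, (Finset.univ.filter fun v : Fin k → V => cls v = c).card ≤ (typeClass n (Qc c)).card)


def cntF {α : Type} [Fintype α] {n : ℕ} (x : Fin n → α) : α → Fin (n + 1) :=
  fun a => ⟨(Finset.univ.filter fun i => x i = a).card, by
    have := Finset.card_le_univ (Finset.univ.filter fun i => x i = a)
    simp only [Fintype.card_fin] at this
    omega⟩

lemma cntF_val {α : Type} [Fintype α] {n : ℕ} (x : Fin n → α) (a : α) :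
    (cntF x a : ℕ) = (Finset.univ.filter fun i => x i = a).card := rfl

lemma empDist_eq_cntF {α : Type} [Fintype α] {n : ℕ} (x : Fin n → α) (a : α) :
    empDist x a = (cntF x a : ℕ) / (n : ℝ) := rfl

lemma empDist_eq_of_cntF {α : Type} [Fintype α] {n : ℕ} {x y : Fin n → α}
    (h : cntF x = cntF y) : empDist x = empDist y := by
  funext a; rw [empDist_eq_cntF, empDist_eq_cntF, h]

lemma cntF_eq_of_empDist {α : Type} [Fintype α] {n : ℕ} (hn : 0 < n) {x y : Fin n → α}
    (h : empDist x = empDist y) : cntF x = cntF y := by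
  funext a
  have := congrFun h a
  rw [empDist_eq_cntF, empDist_eq_cntF] at this
  have hn' : (n : ℝ) ≠ 0 := by positivity
  rw [div_left_inj' hn'] at this
  exact Fin.ext (by exact_mod_cast this)

lemma prod_cntF {α : Type} [Fintype α] {n : ℕ} (x : Fin n → α) (g : α → ℝ) :
    ∏ i, g (x i) = ∏ a, g a ^ (cntF x a : ℕ) := by
  rw [← Finset.prod_fiberwise Finset.univ x (fun i => g (x i))]
  refine Finset.prod_congr rfl fun a _ => ?_
  rw [cntF_val, ← Finset.prod_const]
  refine Finset.prod_congr rfl fun i hi => ?_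
  rw [(Finset.mem_filter.mp hi).2]

lemma sum_cntF {α : Type} [Fintype α] {n : ℕ} (x : Fin n → α) (g : α → ℝ) :
    ∑ i, g (x i) = ∑ a, (cntF x a : ℕ) * g a := by
  rw [← Finset.sum_fiberwise Finset.univ x (fun i => g (x i))]
  refine Finset.sum_congr rfl fun a _ => ?_
  rw [cntF_val, ← nsmul_eq_mul, ← Finset.sum_const]
  refine Finset.sum_congr rfl fun i hi => ?_
  rw [(Finset.mem_filter.mp hi).2]

lemma sum_cntF_nat {α : Type} [Fintype α] {n : ℕ} (x : Fin n → α) :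
    ∑ a, (cntF x a : ℕ) = n := by
  have := sum_cntF x (fun _ => 1)
  simp at this
  exact_mod_cast this.symm

lemma empDist_prob {α : Type} [Fintype α] {n : ℕ} (hn : 0 < n) (x : Fin n → α) :
    IsProbDist (empDist x) := by
  refine ⟨fun a => by unfold empDist; positivity, ?_⟩
  simp only [empDist_eq_cntF]
  rw [← Finset.sum_div]
  have := sum_cntF_nat x
  have h2 : (∑ a, ((cntF x a : ℕ) : ℝ)) = n := by exact_mod_cast this
  rw [h2]; field_simp

lemma cntF_comp {α : Type} [Fintype α] {n : ℕ} (x : Fin n → α) (σ : Equiv.Perm (Fin n)) :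
    cntF (x ∘ σ) = cntF x := by
  funext a
  apply Fin.ext
  rw [cntF_val, cntF_val]
  refine Finset.card_bij (fun i _ => σ i) ?_ ?_ ?_
  · intro i hi; simpa using hi
  · intro i _ j _ h; exact σ.injective h
  · intro j hj; exact ⟨σ.symm j, by simpa using hj, by simp⟩

lemma exists_perm {α : Type} [Fintype α] {n : ℕ} {x y : Fin n → α}
    (h : cntF x = cntF y) : ∃ σ : Equiv.Perm (Fin n), y = x ∘ σ := by
  have e : ∀ a, Nonempty ({i // y i = a} ≃ {i // x i = a}) := by
    intro a
    have h1 := congrArg Fin.val (congrFun h a)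
    rw [cntF_val, cntF_val] at h1
    refine ⟨Fintype.equivOfCardEq ?_⟩
    rw [Fintype.card_subtype, Fintype.card_subtype, h1]
  let e' := fun a => (e a).some
  let σ : Equiv.Perm (Fin n) :=
    (Equiv.sigmaFiberEquiv y).symm.trans ((Equiv.sigmaCongrRight e').trans (Equiv.sigmaFiberEquiv x))
  refine ⟨σ, ?_⟩
  funext i
  exact ((e' (y i)) ⟨i, rfl⟩).2.symm

lemma card_cntF {α : Type} [Fintype α] {n : ℕ} (x : Fin n → α) :
    (Finset.univ.filter fun y : Fin n → α => cntF y = cntF x).card *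
      ∏ a, (cntF x a : ℕ).factorial = n.factorial := by
  have h0 : Fintype.card (Equiv.Perm (Fin n)) = n.factorial := by
    rw [Fintype.card_perm, Fintype.card_fin]
  have hst : (Finset.univ.filter fun σ : Equiv.Perm (Fin n) => x ∘ σ = x).card
      = ∏ a, (cntF x a : ℕ).factorial := by
    rw [← Fintype.card_subtype]
    have := DomMulAct.stabilizer_card x
    rw [this]
    refine Finset.prod_congr rfl fun a _ => ?_
    rw [cntF_val, Fintype.card_subtype]
  rw [← h0, ← hst, ← Finset.card_univ]
  symm
  rw [Finset.card_eq_sum_card_fiberwise (s := Finset.univ) (f := fun σ : Equiv.Perm (Fin n) => x ∘ σ)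
      (t := Finset.univ.filter fun y : Fin n → α => cntF y = cntF x)]
  · rw [Finset.sum_const_nat (m := (Finset.univ.filter fun σ : Equiv.Perm (Fin n) => x ∘ σ = x).card)]
    intro y hy
    obtain ⟨τ, rfl⟩ := exists_perm (Finset.mem_filter.mp hy).2.symm
    refine Finset.card_bij (fun σ _ => σ * τ⁻¹) ?_ ?_ ?_
    · intro σ hσ
      simp only [Finset.mem_filter, Finset.mem_univ, true_and] at hσ ⊢
      funext i
      have := congrFun hσ (τ⁻¹ i)
      simpa using this
    · intro σ _ σ' _ h; exact mul_right_cancel h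
    · intro σ hσ
      refine ⟨σ * τ, ?_, by simp⟩
      simp only [Finset.mem_filter, Finset.mem_univ, true_and] at hσ ⊢
      funext i
      have := congrFun hσ (τ i)
      simpa using this
  · intro σ _
    simp [cntF_comp]

lemma fact_ineq (a b : ℕ) : a.factorial * a ^ b ≤ b.factorial * a ^ a := by
  rcases le_total a b with h | h
  · have := Nat.factorial_mul_pow_sub_le_factorial h
    calc a.factorial * a ^ b = (a.factorial * a ^ (b - a)) * a ^ a := by
          rw [mul_assoc, ← pow_add, Nat.sub_add_cancel h]
      _ ≤ _ := Nat.mul_le_mul_right _ this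
  · have h1 := Nat.factorial_mul_descFactorial (n := a) (k := a - b) (Nat.sub_le _ _)
    rw [Nat.sub_sub_self h] at h1
    have h2 := Nat.descFactorial_le_pow a (a - b)
    calc a.factorial * a ^ b = b.factorial * (a.descFactorial (a - b) * a ^ b) := by
          rw [← h1]; ring
      _ ≤ b.factorial * (a ^ (a - b) * a ^ b) := by gcongr
      _ = _ := by rw [← pow_add, Nat.sub_add_cancel h]

lemma typeClass_eq {α : Type} [Fintype α] {n : ℕ} (hn : 0 < n) (x : Fin n → α) :
    typeClass n (empDist x) = Finset.univ.filter fun y => cntF y = cntF x := by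
  ext y
  simp only [typeClass, Finset.mem_filter, Finset.mem_univ, true_and]
  exact ⟨cntF_eq_of_empDist hn, empDist_eq_of_cntF⟩

lemma fiber_le {α : Type} [Fintype α] {n : ℕ} (hn : 0 < n) (x y : Fin n → α) :
    ((Finset.univ.filter fun z : Fin n → α => cntF z = cntF y).card : ℝ) * ∏ i, empDist x (y i) ≤
    ((Finset.univ.filter fun z : Fin n → α => cntF z = cntF x).card : ℝ) *
      ∏ i, empDist x (x i) := by
  have hx := card_cntF x
  have hy := card_cntF y
  set M := (Finset.univ.filter fun z : Fin n → α => cntF z = cntF x).card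
  set M' := (Finset.univ.filter fun z : Fin n → α => cntF z = cntF y).card
  rw [prod_cntF y, prod_cntF x]
  simp only [empDist_eq_cntF, div_pow]
  rw [Finset.prod_div_distrib, Finset.prod_div_distrib, Finset.prod_pow_eq_pow_sum,
    Finset.prod_pow_eq_pow_sum, sum_cntF_nat, sum_cntF_nat, ← mul_div_assoc, ← mul_div_assoc]
  apply div_le_div_of_nonneg_right _ (by positivity)
  have key : (∏ a, (cntF x a : ℕ).factorial) * ∏ a, (cntF x a : ℕ) ^ (cntF y a : ℕ) ≤
      (∏ a, (cntF y a : ℕ).factorial) * ∏ a, (cntF x a : ℕ) ^ (cntF x a : ℕ) := by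
    rw [← Finset.prod_mul_distrib, ← Finset.prod_mul_distrib]
    exact Finset.prod_le_prod' fun a _ => fact_ineq _ _
  set Fx := ∏ a, (cntF x a : ℕ).factorial
  set Fy := ∏ a, (cntF y a : ℕ).factorial
  have hFx : 0 < Fx := Finset.prod_pos fun a _ => Nat.factorial_pos _
  have hFy : 0 < Fy := Finset.prod_pos fun a _ => Nat.factorial_pos _
  have : M' * ∏ a, (cntF x a : ℕ) ^ (cntF y a : ℕ) ≤ M * ∏ a, (cntF x a : ℕ) ^ (cntF x a : ℕ) := by
    refine Nat.le_of_mul_le_mul_left ?_ (Nat.mul_pos hFx hFy)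
    calc Fx * Fy * (M' * ∏ a, (cntF x a : ℕ) ^ (cntF y a : ℕ))
        = (M' * Fy) * (Fx * ∏ a, (cntF x a : ℕ) ^ (cntF y a : ℕ)) := by ring
      _ ≤ (M' * Fy) * (Fy * ∏ a, (cntF x a : ℕ) ^ (cntF x a : ℕ)) := by gcongr
      _ = (M * Fx) * (Fy * ∏ a, (cntF x a : ℕ) ^ (cntF x a : ℕ)) := by rw [hx, hy]
      _ = _ := by ring
  exact_mod_cast this

lemma typeClass_size {α : Type} [Fintype α] {n : ℕ} (hn : 0 < n) (x : Fin n → α) :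
    1 ≤ ((n : ℝ) + 1) ^ (Fintype.card α) * ((typeClass n (empDist x)).card : ℝ) *
      ∏ i, empDist x (x i) := by
  rw [typeClass_eq hn]
  have h1 : (1 : ℝ) = ∑ y : Fin n → α, ∏ i, empDist x (y i) := by
    rw [← Fintype.prod_sum (fun (_ : Fin n) a => empDist x a)]
    simp [(empDist_prob hn x).2]
  refine h1.trans_le ?_
  rw [← Finset.sum_fiberwise Finset.univ (cntF (n := n) (α := α))]
  calc _ ≤ ∑ τ : α → Fin (n + 1),
        ((Finset.univ.filter fun z : Fin n → α => cntF z = cntF x).card : ℝ) *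
      ∏ i, empDist x (x i) := ?_
    _ = _ := by
      rw [Finset.sum_const, nsmul_eq_mul, Finset.card_univ, Fintype.card_fun, Fintype.card_fin]
      push_cast; ring
  refine Finset.sum_le_sum fun τ _ => ?_
  by_cases hτ : ∃ y : Fin n → α, cntF y = τ
  · obtain ⟨y, rfl⟩ := hτ
    refine le_trans (le_of_eq ?_) (fiber_le hn x y)
    rw [← nsmul_eq_mul, ← Finset.sum_const]
    refine Finset.sum_congr rfl fun z hz => ?_
    rw [prod_cntF z, prod_cntF y, (Finset.mem_filter.mp hz).2]
  · rw [Finset.filter_false_of_mem (fun y _ hy => hτ ⟨y, hy⟩)]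
    simp only [Finset.sum_empty]
    have : ∀ a, 0 ≤ empDist x a := (empDist_prob hn x).1
    exact mul_nonneg (Nat.cast_nonneg _) (Finset.prod_nonneg fun i _ => this _)

lemma bhat_le_one {X Y : Type} [Fintype Y] {W : X → Y → ℝ} (hW : IsDMC W) (x x' : X) :
    ∑ y, Real.sqrt (W x y * W x' y) ≤ 1 := by
  have h : ∀ y, Real.sqrt (W x y * W x' y) ≤ (W x y + W x' y) / 2 := by
    intro y
    have h1 := hW.1 x y
    have h2 := hW.1 x' y
    apply Real.sqrt_le_iff.mpr
    constructor
    · positivity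
    · nlinarith [sq_nonneg (W x y - W x' y)]
  calc _ ≤ ∑ y, (W x y + W x' y) / 2 := Finset.sum_le_sum fun y _ => h y
    _ = 1 := by rw [← Finset.sum_div, Finset.sum_add_distrib, hW.2, hW.2]; norm_num

lemma dB_nonneg {X Y : Type} [Fintype Y] {W : X → Y → ℝ} (hW : IsDMC W) (x x' : X) :
    0 ≤ dB W x x' := by
  unfold dB
  have := Real.log_nonpos (Finset.sum_nonneg fun y (_ : y ∈ Finset.univ) => Real.sqrt_nonneg (W x y * W x' y))
    (bhat_le_one hW x x')
  linarith

lemma dB_symm {X Y : Type} [Fintype Y] (W : X → Y → ℝ) (x x' : X) :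
    dB W x x' = dB W x' x := by
  unfold dB
  simp only [mul_comm]

lemma bhat_le_exp {X Y : Type} [Fintype Y] (W : X → Y → ℝ) (x x' : X) :
    ∑ y, Real.sqrt (W x y * W x' y) ≤ Real.exp (-dB W x x') := by
  unfold dB
  rw [neg_neg]
  exact Real.le_exp_log _

/-- Product Bhattacharyya coefficient, raised to the power `1/ρ`. -/
def Bn {X Y : Type} [Fintype Y] (W : X → Y → ℝ) (ρ : ℝ) {n : ℕ} (x x' : Fin n → X) : ℝ :=
  ∏ i, Real.exp (-dB W (x i) (x' i) / ρ)

lemma Bn_pos {X Y : Type} [Fintype Y] (W : X → Y → ℝ) (ρ : ℝ) {n : ℕ} (x x' : Fin n → X) :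
    0 < Bn W ρ x x' := Finset.prod_pos fun _ _ => Real.exp_pos _

lemma Bn_symm {X Y : Type} [Fintype Y] (W : X → Y → ℝ) (ρ : ℝ) {n : ℕ} (x x' : Fin n → X) :
    Bn W ρ x x' = Bn W ρ x' x := by
  unfold Bn
  simp only [dB_symm W (x _) (x' _)]

lemma Bn_perm {X Y : Type} [Fintype Y] (W : X → Y → ℝ) (ρ : ℝ) {n : ℕ} (x x' : Fin n → X)
    (σ : Equiv.Perm (Fin n)) : Bn W ρ (x ∘ σ) (x' ∘ σ) = Bn W ρ x x' := by
  unfold Bn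
  exact Equiv.prod_comp σ (fun i => Real.exp (-dB W (x i) (x' i) / ρ))

lemma Bn_rpow {X Y : Type} [Fintype Y] (W : X → Y → ℝ) {ρ : ℝ} (hρ : 1 ≤ ρ) {n : ℕ}
    (x x' : Fin n → X) : Bn W 1 x x' = (Bn W ρ x x') ^ ρ := by
  unfold Bn
  rw [← Real.finsetProd_rpow _ _ (fun i _ => (Real.exp_pos _).le)]
  refine Finset.prod_congr rfl fun i _ => ?_
  rw [← Real.exp_mul]
  congr 1
  field_simp

lemma Bn_jt {X Y : Type} [Fintype X] [Fintype Y] (W : X → Y → ℝ) (ρ : ℝ) {n : ℕ}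
    (x x' : Fin n → X) : Bn W ρ x x' =
      ∏ p : X × X, Real.exp (-dB W p.1 p.2 / ρ) ^ (cntF (fun i => (x i, x' i)) p : ℕ) := by
  rw [← prod_cntF (fun i => (x i, x' i)) (fun p => Real.exp (-dB W p.1 p.2 / ρ))]
  rfl

lemma bhat_prod_le {X Y : Type} [Fintype X] [Fintype Y] {W : X → Y → ℝ} (hW : IsDMC W) {n : ℕ}
    (x x' : Fin n → X) :
    ∑ y : Fin n → Y, Real.sqrt (Wn W x y * Wn W x' y) ≤ Bn W 1 x x' := by
  have h : ∀ y : Fin n → Y, Real.sqrt (Wn W x y * Wn W x' y) =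
      ∏ i, Real.sqrt (W (x i) (y i) * W (x' i) (y i)) := by
    intro y
    unfold Wn
    rw [← Finset.prod_mul_distrib]
    exact Real.sqrt_prod _ fun i _ => mul_nonneg (hW.1 _ _) (hW.1 _ _)
  simp only [h]
  rw [← Fintype.prod_sum (fun (i : Fin n) y => Real.sqrt (W (x i) y * W (x' i) y))]
  unfold Bn
  refine Finset.prod_le_prod (fun i _ => Finset.sum_nonneg fun y _ => Real.sqrt_nonneg _)
    fun i _ => ?_
  rw [div_one]
  exact bhat_le_exp W _ _

/-- The functional in the definition of `Ex'`. -/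
def valx {X Y : Type} [Fintype X] [Fintype Y] (W : X → Y → ℝ) (Q Q' : X → ℝ) (ρ : ℝ) : ℝ :=
  -ρ * ∑ x, Q x * Real.log (∑ x', Q' x' * Real.exp (-dB W x x' / ρ))

lemma inner_pos {X Y : Type} [Fintype X] [Fintype Y] (W : X → Y → ℝ) {Q' : X → ℝ}
    (hQ' : IsProbDist Q') (ρ : ℝ) (x : X) :
    0 < ∑ x', Q' x' * Real.exp (-dB W x x' / ρ) := by
  have h0 : ∃ a, 0 < Q' a := by
    by_contra hcon
    push Not at hcon
    have := Finset.sum_nonpos (fun a (_ : a ∈ Finset.univ) => hcon a)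
    rw [hQ'.2] at this
    linarith
  obtain ⟨a, ha⟩ := h0
  exact Finset.sum_pos' (fun b _ => mul_nonneg (hQ'.1 b) (Real.exp_pos _).le)
    ⟨a, Finset.mem_univ _, mul_pos ha (Real.exp_pos _)⟩

lemma valx_nonneg {X Y : Type} [Fintype X] [Fintype Y] {W : X → Y → ℝ} (hW : IsDMC W)
    {Q Q' : X → ℝ} (hQ : IsProbDist Q) (hQ' : IsProbDist Q') {ρ : ℝ} (hρ : 1 ≤ ρ) :
    0 ≤ valx W Q Q' ρ := by
  unfold valx
  have : ∑ x, Q x * Real.log (∑ x', Q' x' * Real.exp (-dB W x x' / ρ)) ≤ 0 := by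
    refine Finset.sum_nonpos fun x _ => mul_nonpos_of_nonneg_of_nonpos (hQ.1 x) ?_
    refine Real.log_nonpos (inner_pos W hQ' ρ x).le ?_
    rw [← hQ'.2]
    refine Finset.sum_le_sum fun x' _ => mul_le_of_le_one_right (hQ'.1 x') ?_
    rw [Real.exp_le_one_iff]
    have := dB_nonneg hW x x'
    exact div_nonpos_of_nonpos_of_nonneg (by linarith) (by linarith)
  nlinarith

lemma Ex'_le {X Y : Type} [Fintype X] [Fintype Y] {W : X → Y → ℝ} (hW : IsDMC W)
    {Q Q' : X → ℝ} (hQ : IsProbDist Q) (hQ' : IsProbDist Q') {ρ : ℝ} (hρ : 1 ≤ ρ) :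
    Ex' W Q ρ ≤ valx W Q Q' ρ := by
  refine csInf_le ⟨0, ?_⟩ ⟨Q', hQ', rfl⟩
  rintro z ⟨Q'', hQ'', rfl⟩
  exact valx_nonneg hW hQ hQ'' hρ

lemma valx_le {X Y : Type} [Fintype X] [Fintype Y] {W : X → Y → ℝ}
    {Q Q' : X → ℝ} (hQ : IsProbDist Q) (hQ' : IsProbDist Q') {ρ : ℝ} (hρ : 1 ≤ ρ) :
    valx W Q Q' ρ ≤ ∑ x, Q x * ∑ x', Q' x' * dB W x x' := by
  unfold valx
  rw [neg_mul, ← mul_neg, ← Finset.sum_neg_distrib, Finset.mul_sum]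
  refine Finset.sum_le_sum fun x _ => ?_
  have h1 : Real.exp (∑ x', Q' x' * (-dB W x x' / ρ)) ≤
      ∑ x', Q' x' * Real.exp (-dB W x x' / ρ) := by
    have := convexOn_exp.map_sum_le (t := Finset.univ) (w := Q')
      (p := fun x' => -dB W x x' / ρ) (fun i _ => hQ'.1 i) hQ'.2 (fun i _ => Set.mem_univ _)
    simpa [smul_eq_mul] using this
  have h2 := (Real.le_log_iff_exp_le (inner_pos W hQ' ρ x)).mpr h1
  have h3 : ∑ x', Q' x' * (-dB W x x' / ρ) = -(∑ x', Q' x' * dB W x x') / ρ := by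
    rw [← Finset.sum_neg_distrib, Finset.sum_div]
    refine Finset.sum_congr rfl fun x' _ => by ring
  rw [h3, div_le_iff₀ (by linarith)] at h2
  have h4 := hQ.1 x
  nlinarith

lemma exp_neg_le_quad {u : ℝ} (hu : 0 ≤ u) : Real.exp (-u) ≤ 1 - u + u ^ 2 := by
  rw [Real.exp_neg]
  have h1 : 1 + u ≤ Real.exp u := by linarith [Real.add_one_le_exp u]
  have h2 : (Real.exp u)⁻¹ ≤ (1 + u)⁻¹ := by gcongr
  refine h2.trans ?_
  rw [inv_le_iff_one_le_mul₀ (by linarith)]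
  nlinarith [pow_nonneg hu 3]

lemma valx_ge {X Y : Type} [Fintype X] [Fintype Y] {W : X → Y → ℝ} (hW : IsDMC W)
    {Q Q' : X → ℝ} (hQ : IsProbDist Q) (hQ' : IsProbDist Q') {ρ : ℝ} (hρ : 1 ≤ ρ)
    {D : ℝ} (hD : ∀ x x', dB W x x' ≤ D) :
    ∑ x, Q x * ∑ x', Q' x' * dB W x x' ≤ valx W Q Q' ρ + D ^ 2 / ρ := by
  unfold valx
  have hρ0 : 0 < ρ := by linarith
  have e1 : D ^ 2 / ρ = ∑ x, Q x * (D ^ 2 / ρ) := by rw [← Finset.sum_mul, hQ.2, one_mul]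
  rw [neg_mul, ← mul_neg, ← Finset.sum_neg_distrib, Finset.mul_sum, e1, ← Finset.sum_add_distrib]
  refine Finset.sum_le_sum fun x _ => ?_
  have h1 : ∑ x', Q' x' * Real.exp (-dB W x x' / ρ) ≤
      ∑ x', Q' x' * (1 - dB W x x' / ρ + D ^ 2 / ρ ^ 2) := by
    refine Finset.sum_le_sum fun x' _ => mul_le_mul_of_nonneg_left ?_ (hQ'.1 x')
    have hd := dB_nonneg hW x x'
    have := exp_neg_le_quad (u := dB W x x' / ρ) (by positivity)
    rw [neg_div]
    refine this.trans ?_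
    rw [div_pow]
    have := hD x x'
    gcongr
  have h2 : ∑ x', Q' x' * (1 - dB W x x' / ρ + D ^ 2 / ρ ^ 2) =
      1 - (∑ x', Q' x' * dB W x x') / ρ + D ^ 2 / ρ ^ 2 := by
    have : ∀ x', Q' x' * (1 - dB W x x' / ρ + D ^ 2 / ρ ^ 2) =
      Q' x' * (1 + D ^ 2 / ρ ^ 2) - Q' x' * dB W x x' / ρ := fun x' => by ring
    simp only [this]
    rw [Finset.sum_sub_distrib, ← Finset.sum_mul, hQ'.2, Finset.sum_div]
    ring
  have h3 := Real.log_le_sub_one_of_pos (inner_pos W hQ' ρ x)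
  rw [h2] at h1
  have h4 : Real.log (∑ x', Q' x' * Real.exp (-dB W x x' / ρ)) ≤
    - (∑ x', Q' x' * dB W x x') / ρ + D ^ 2 / ρ ^ 2 := by
    have : - (∑ x', Q' x' * dB W x x') / ρ = -((∑ x', Q' x' * dB W x x') / ρ) := by ring
    linarith
  have h5 : ρ * Real.log (∑ x', Q' x' * Real.exp (-dB W x x' / ρ)) ≤
    - (∑ x', Q' x' * dB W x x') + D ^ 2 / ρ := by
    calc _ ≤ ρ * (- (∑ x', Q' x' * dB W x x') / ρ + D ^ 2 / ρ ^ 2) := by gcongr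
      _ = _ := by field_simp
  have h6 := hQ.1 x
  nlinarith

lemma Ex'_growth {X Y : Type} [Fintype X] [Fintype Y] {W : X → Y → ℝ} (hW : IsDMC W)
    {Q : X → ℝ} (hQ : IsProbDist Q) {ρ ρ₀ : ℝ} (hρ : 1 ≤ ρ) (hρ₀ : 1 ≤ ρ₀)
    {D : ℝ} (hD : ∀ x x', dB W x x' ≤ D) :
    Ex' W Q ρ ≤ Ex' W Q ρ₀ + D ^ 2 / ρ₀ := by
  rw [← sub_le_iff_le_add]
  refine le_csInf ⟨_, Q, hQ, rfl⟩ ?_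
  rintro z ⟨Q', hQ', rfl⟩
  have h1 := Ex'_le hW hQ hQ' hρ
  have h2 := valx_le (W := W) hQ hQ' hρ
  have h3 := valx_ge hW hQ hQ' hρ₀ hD
  change _ ≤ valx W Q Q' ρ₀
  linarith

lemma avg_bound {X Y : Type} [Fintype X] [Fintype Y] {W : X → Y → ℝ} (hW : IsDMC W)
    {n : ℕ} (hn : 0 < n) {ρ : ℝ} (hρ : 1 ≤ ρ) {Q Q' : X → ℝ} {x : Fin n → X}
    (hx : x ∈ typeClass n Q) (hQ' : IsType n Q') :
    ∑ x' ∈ typeClass n Q', Bn W ρ x x' ≤ (typeClass n Q').card *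
      (((n : ℝ) + 1) ^ Fintype.card X * Real.exp (-(n / ρ * Ex' W Q ρ))) := by
  obtain ⟨x0, rfl⟩ := hQ'
  obtain rfl : empDist x = Q := (Finset.mem_filter.mp hx).2
  have hρ0 : 0 < ρ := by linarith
  have hn0 : (0 : ℝ) < n := by exact_mod_cast hn
  set Q' := empDist x0
  have hQ' : IsProbDist Q' := empDist_prob hn x0
  set c : ℝ := ((n : ℝ) + 1) ^ Fintype.card X * ((typeClass n Q').card : ℝ)
  have hc : 0 ≤ c := by positivity
  have h1 : ∀ x' ∈ typeClass n Q', Bn W ρ x x' ≤ c * ((∏ i, Q' (x' i)) * Bn W ρ x x') := by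
    intro x' hx'
    have h := typeClass_size hn x'
    have e : empDist x' = Q' := (Finset.mem_filter.mp hx').2
    rw [e] at h
    rw [← mul_assoc]
    exact le_mul_of_one_le_left (Bn_pos _ _ _ _).le h
  have h2 : ∑ x' : Fin n → X, (∏ i, Q' (x' i)) * Bn W ρ x x' =
      Real.exp (-(n / ρ * valx W (empDist x) Q' ρ)) := by
    unfold Bn
    simp only [← Finset.prod_mul_distrib]
    rw [← Fintype.prod_sum (fun i b => Q' b * Real.exp (-dB W (x i) b / ρ))]
    have : ∀ i, ∑ b, Q' b * Real.exp (-dB W (x i) b / ρ) =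
      Real.exp (Real.log (∑ b, Q' b * Real.exp (-dB W (x i) b / ρ))) := fun i =>
        (Real.exp_log (inner_pos W hQ' ρ (x i))).symm
    rw [Finset.prod_congr rfl fun i _ => this i, ← Real.exp_sum]
    congr 1
    rw [sum_cntF x (fun a => Real.log (∑ b, Q' b * Real.exp (-dB W a b / ρ)))]
    unfold valx
    rw [Finset.mul_sum, Finset.mul_sum, ← Finset.sum_neg_distrib]
    refine Finset.sum_congr rfl fun a _ => ?_
    rw [empDist_eq_cntF]
    field_simp
  calc _ ≤ ∑ x' ∈ typeClass n Q', c * ((∏ i, Q' (x' i)) * Bn W ρ x x') := Finset.sum_le_sum h1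
    _ ≤ ∑ x' : Fin n → X, c * ((∏ i, Q' (x' i)) * Bn W ρ x x') := by
      refine Finset.sum_le_univ_sum_of_nonneg fun x' => ?_
      exact mul_nonneg hc (mul_nonneg (Finset.prod_nonneg fun i _ => hQ'.1 _) (Bn_pos _ _ _ _).le)
    _ = c * Real.exp (-(n / ρ * valx W (empDist x) Q' ρ)) := by rw [← Finset.mul_sum, h2]
    _ ≤ c * Real.exp (-(n / ρ * Ex' W (empDist x) ρ)) := by
      have := Ex'_le hW (empDist_prob hn x) hQ' hρ
      gcongr
    _ = _ := by simp only [c]; ring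

lemma sum_typeClass_const {X Y : Type} [Fintype X] [Fintype Y] (W : X → Y → ℝ)
    {n : ℕ} (hn : 0 < n) (ρ : ℝ) {Q Q' : X → ℝ} {x x1 : Fin n → X}
    (hx : x ∈ typeClass n Q) (hx1 : x1 ∈ typeClass n Q) :
    ∑ x' ∈ typeClass n Q', Bn W ρ x x' = ∑ x' ∈ typeClass n Q', Bn W ρ x1 x' := by
  have e : empDist x = empDist x1 :=
    (Finset.mem_filter.mp hx).2.trans (Finset.mem_filter.mp hx1).2.symm
  obtain ⟨σ, rfl⟩ := exists_perm (cntF_eq_of_empDist hn e)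
  refine Finset.sum_bij (fun x' _ => x' ∘ σ) ?_ ?_ ?_ ?_
  · intro x' hx'
    simp only [typeClass, Finset.mem_filter, Finset.mem_univ, true_and] at hx' ⊢
    rw [← hx']
    exact empDist_eq_of_cntF (cntF_comp x' σ)
  · intro a _ b _ h
    funext i
    have := congrFun h (σ.symm i)
    simpa using this
  · intro b hb
    refine ⟨b ∘ σ.symm, ?_, ?_⟩
    · simp only [typeClass, Finset.mem_filter, Finset.mem_univ, true_and] at hb ⊢
      rw [← hb]
      exact empDist_eq_of_cntF (cntF_comp b σ.symm)
    · funext i; simp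
  · intro a _
    exact (Bn_perm W ρ x a σ).symm

lemma avg_bound' {X Y : Type} [Fintype X] [Fintype Y] {W : X → Y → ℝ} (hW : IsDMC W)
    {n : ℕ} (hn : 0 < n) {ρ : ℝ} (hρ : 1 ≤ ρ) {Q Q' : X → ℝ} {x : Fin n → X}
    (hx : x ∈ typeClass n Q) (hQ' : IsType n Q') :
    ∑ x' ∈ typeClass n Q', Bn W ρ x x' ≤ (typeClass n Q').card *
      (((n : ℝ) + 1) ^ Fintype.card X * Real.exp (-(n / ρ * Ex' W Q' ρ))) := by
  have hT : (0 : ℝ) < (typeClass n Q).card := by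
    exact_mod_cast Finset.card_pos.mpr ⟨x, hx⟩
  refine le_of_mul_le_mul_left ?_ hT
  calc ((typeClass n Q).card : ℝ) * ∑ x' ∈ typeClass n Q', Bn W ρ x x'
      = ∑ x1 ∈ typeClass n Q, ∑ x' ∈ typeClass n Q', Bn W ρ x1 x' := by
        rw [← nsmul_eq_mul, ← Finset.sum_const]
        exact Finset.sum_congr rfl fun x1 hx1 => sum_typeClass_const W hn ρ hx hx1
    _ = ∑ x' ∈ typeClass n Q', ∑ x1 ∈ typeClass n Q, Bn W ρ x' x1 := by
        rw [Finset.sum_comm]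
        exact Finset.sum_congr rfl fun x' _ => Finset.sum_congr rfl fun x1 _ => Bn_symm _ _ _ _
    _ ≤ ∑ x' ∈ typeClass n Q', ((typeClass n Q).card : ℝ) *
      (((n : ℝ) + 1) ^ Fintype.card X * Real.exp (-(n / ρ * Ex' W Q' ρ))) :=
        Finset.sum_le_sum fun x' hx' => avg_bound hW hn hρ hx' ⟨x, (Finset.mem_filter.mp hx).2⟩
    _ = _ := by rw [Finset.sum_const, nsmul_eq_mul]; ring

lemma exists_good {β I : Type} [Fintype I] (T : Finset β) (hT : T.Nonempty) (h : I → β → ℝ)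
    (h0 : ∀ i x, 0 ≤ h i x) :
    ∃ x ∈ T, ∀ i, (T.card : ℝ) * h i x ≤ Fintype.card I * ∑ x' ∈ T, h i x' := by
  have hc : (0 : ℝ) < T.card := by exact_mod_cast hT.card_pos
  have hs : ∑ x ∈ T, ∑ i, h i x / (∑ x' ∈ T, h i x') ≤
      ∑ x ∈ T, (Fintype.card I : ℝ) / T.card := by
    rw [Finset.sum_comm, Finset.sum_const, nsmul_eq_mul, mul_div_cancel₀ _ hc.ne']
    calc _ ≤ ∑ i : I, (1 : ℝ) := by
          refine Finset.sum_le_sum fun i _ => ?_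
          rw [← Finset.sum_div]
          exact div_self_le_one _
      _ = _ := by simp
  obtain ⟨x, hx, hle⟩ := Finset.exists_le_of_sum_le hT hs
  refine ⟨x, hx, fun i => ?_⟩
  have hm : 0 ≤ ∑ x' ∈ T, h i x' := Finset.sum_nonneg fun _ _ => h0 _ _
  have hsingle : h i x ≤ ∑ x' ∈ T, h i x' :=
    Finset.single_le_sum (f := fun x' => h i x') (fun _ _ => h0 _ _) hx
  rcases hm.eq_or_lt with hm0 | hm0
  · have : h i x = 0 := le_antisymm (by linarith) (h0 _ _)
    rw [this, ← hm0]; simp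
  · have h1 : h i x / (∑ x' ∈ T, h i x') ≤ Fintype.card I / T.card := by
      refine le_trans ?_ hle
      exact Finset.single_le_sum (f := fun i => h i x / (∑ x' ∈ T, h i x'))
        (fun j _ => div_nonneg (h0 _ _) (Finset.sum_nonneg fun _ _ => h0 _ _)) (Finset.mem_univ i)
    rw [div_le_div_iff₀ hm0 hc] at h1
    linarith

lemma step1 {A Λ X Y : Type} [Fintype Λ] [DecidableEq Λ] [Fintype X] [Fintype Y] (W : X → Y → ℝ)
    {n : ℕ} (T : Finset (Fin n → X)) (hT : T.Nonempty) (s : Finset A) (ty : A → Λ)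
    (f : A → Fin n → X) :
    ∃ x ∈ T, ∀ (l : Λ) (ρ : ℝ),
      (T.card : ℝ) * ∑ v ∈ s.filter (fun v => ty v = l), Bn W ρ (f v) x ≤
      ((Fintype.card Λ : ℝ) * ((n : ℝ) + 1) ^ Fintype.card (X × X)) *
        ∑ v ∈ s.filter (fun v => ty v = l), ∑ x' ∈ T, Bn W ρ (f v) x' := by
  obtain ⟨x, hx, hg⟩ := exists_good (I := Λ × (X × X → Fin (n + 1))) T hT
    (fun i x => ∑ v ∈ s.filter (fun v => ty v = i.1),
      if cntF (fun j => (f v j, x j)) = i.2 then (1 : ℝ) else 0)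
    (fun i x => Finset.sum_nonneg fun v _ => by split_ifs <;> norm_num)
  refine ⟨x, hx, fun l ρ => ?_⟩
  have hcard : (Fintype.card (Λ × (X × X → Fin (n + 1))) : ℝ) =
      (Fintype.card Λ : ℝ) * ((n : ℝ) + 1) ^ Fintype.card (X × X) := by
    rw [Fintype.card_prod, Fintype.card_fun, Fintype.card_fin]; push_cast; rfl
  rw [hcard] at hg
  set K := (Fintype.card Λ : ℝ) * ((n : ℝ) + 1) ^ Fintype.card (X × X)
  let g : (X × X → Fin (n + 1)) → ℝ := fun τ =>
    ∏ p : X × X, Real.exp (-dB W p.1 p.2 / ρ) ^ (τ p : ℕ)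
  have hg0 : ∀ τ, 0 ≤ g τ := fun τ => Finset.prod_nonneg fun p _ => by positivity
  have hB : ∀ x' : Fin n → X, ∑ v ∈ s.filter (fun v => ty v = l), Bn W ρ (f v) x' =
      ∑ τ, g τ * ∑ v ∈ s.filter (fun v => ty v = l),
        if cntF (fun j => (f v j, x' j)) = τ then (1 : ℝ) else 0 := by
    intro x'
    simp only [Finset.mul_sum]
    rw [Finset.sum_comm]
    refine Finset.sum_congr rfl fun v _ => ?_
    rw [Bn_jt]
    simp [g]
  rw [Finset.sum_comm, hB, Finset.mul_sum]
  simp only [hB]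
  rw [Finset.sum_comm, Finset.mul_sum]
  refine Finset.sum_le_sum fun τ _ => ?_
  rw [← Finset.mul_sum]
  have := mul_le_mul_of_nonneg_left (hg (l, τ)) (hg0 τ)
  simp only at this
  linarith

lemma sum_rpow_le' {A : Type} (s : Finset A) (u : A → ℝ) (hu : ∀ a, 0 < u a) {ρ : ℝ} (hρ : 1 ≤ ρ) :
    ∑ a ∈ s, u a ^ ρ ≤ (∑ a ∈ s, u a) ^ ρ := by
  rcases s.eq_empty_or_nonempty with rfl | hs
  · simp [Real.zero_rpow (by linarith : ρ ≠ 0)]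
  have hS : 0 < ∑ a ∈ s, u a := Finset.sum_pos (fun a _ => hu a) hs
  have e : ∀ y : ℝ, 0 < y → y ^ ρ = y * y ^ (ρ - 1) := by
    intro y hy
    rw [Real.rpow_sub_one hy.ne']; field_simp
  rw [e _ hS, Finset.sum_mul]
  refine Finset.sum_le_sum fun a ha => ?_
  rw [e _ (hu a)]
  have h1 : u a ≤ ∑ a ∈ s, u a := Finset.single_le_sum (fun b _ => (hu b).le) ha
  exact mul_le_mul_of_nonneg_left
    (Real.rpow_le_rpow (hu a).le h1 (by linarith)) (hu a).le

lemma step2 {A X Y : Type} [Fintype X] [Fintype Y] (W : X → Y → ℝ)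
    {n : ℕ} (T : Finset (Fin n → X)) (hT : T.Nonempty) (s : Finset A)
    (f : A → Fin n → X) (x : Fin n → X) {K P N E ρ : ℝ} (hρ : 1 ≤ ρ) (hK : 0 ≤ K) (hP : 0 ≤ P)
    (hN : (s.card : ℝ) ≤ N)
    (h1 : (T.card : ℝ) * ∑ v ∈ s, Bn W ρ (f v) x ≤ K * ∑ v ∈ s, ∑ x' ∈ T, Bn W ρ (f v) x')
    (h2 : ∀ v ∈ s, ∑ x' ∈ T, Bn W ρ (f v) x' ≤ T.card * (P * Real.exp (-(n / ρ * E)))) :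
    ∑ v ∈ s, Bn W 1 (f v) x ≤ (K * P) ^ ρ * N ^ ρ * Real.exp (-(n * E)) := by
  have hc : (0 : ℝ) < T.card := by exact_mod_cast hT.card_pos
  have hN0 : 0 ≤ N := le_trans (Nat.cast_nonneg _) hN
  have h3 : ∑ v ∈ s, Bn W ρ (f v) x ≤ K * P * N * Real.exp (-(n / ρ * E)) := by
    refine le_of_mul_le_mul_left (h1.trans ?_) hc
    calc _ ≤ K * ∑ v ∈ s, T.card * (P * Real.exp (-(n / ρ * E))) := by
          exact mul_le_mul_of_nonneg_left (Finset.sum_le_sum h2) hK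
      _ = K * (s.card * (T.card * (P * Real.exp (-(n / ρ * E))))) := by
          rw [Finset.sum_const, nsmul_eq_mul]
      _ ≤ K * (N * (T.card * (P * Real.exp (-(n / ρ * E))))) := by gcongr
      _ = _ := by ring
  calc _ = ∑ v ∈ s, (Bn W ρ (f v) x) ^ ρ := Finset.sum_congr rfl fun v _ => Bn_rpow W hρ _ _
    _ ≤ (∑ v ∈ s, Bn W ρ (f v) x) ^ ρ := sum_rpow_le' _ _ (fun v => Bn_pos _ _ _ _) hρ
    _ ≤ (K * P * N * Real.exp (-(n / ρ * E))) ^ ρ :=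
        Real.rpow_le_rpow (Finset.sum_nonneg fun v _ => (Bn_pos _ _ _ _).le) h3 (by linarith)
    _ = _ := by
        rw [Real.mul_rpow (by positivity) (by positivity), Real.mul_rpow (by positivity) hN0,
          ← Real.exp_mul]
        congr 2
        field_simp

lemma all_rho {n : ℕ} {b κ N ρ₀ δ C : ℝ} {E : ℝ → ℝ} (hκ : 1 ≤ κ) (hN : 1 ≤ N) (hρ₀ : 1 ≤ ρ₀)
    (hδ : 0 ≤ δ) (hE : ∀ ρ, 1 ≤ ρ → E ρ ≤ E ρ₀ + δ)
    (hC : κ ^ ρ₀ * Real.exp (n * δ) ≤ C)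
    (hb : ∀ ρ, 1 ≤ ρ → b ≤ κ ^ ρ * N ^ ρ * Real.exp (-(n * E ρ))) (ρ : ℝ) (hρ : 1 ≤ ρ) :
    b ≤ C * (N ^ ρ * Real.exp (-(n * E ρ))) := by
  have hn : (0 : ℝ) ≤ n := Nat.cast_nonneg _
  have hκ0 : 0 < κ := by linarith
  have hN0 : 0 < N := by linarith
  rcases le_total ρ ρ₀ with h | h
  · calc b ≤ κ ^ ρ * N ^ ρ * Real.exp (-(n * E ρ)) := hb ρ hρ
      _ = κ ^ ρ * (N ^ ρ * Real.exp (-(n * E ρ))) := by ring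
      _ ≤ C * _ := by
        gcongr
        calc κ ^ ρ ≤ κ ^ ρ₀ := Real.rpow_le_rpow_of_exponent_le hκ h
          _ = κ ^ ρ₀ * 1 := by ring
          _ ≤ κ ^ ρ₀ * Real.exp (n * δ) := by
            gcongr
            exact Real.one_le_exp (by positivity)
          _ ≤ C := hC
  · calc b ≤ κ ^ ρ₀ * N ^ ρ₀ * Real.exp (-(n * E ρ₀)) := hb ρ₀ hρ₀
      _ ≤ κ ^ ρ₀ * N ^ ρ * Real.exp (n * δ + -(n * E ρ)) := by
        have h1 := Real.rpow_le_rpow_of_exponent_le hN h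
        have h2 := mul_le_mul_of_nonneg_left (hE ρ hρ) hn
        have h3 : -(n * E ρ₀) ≤ n * δ + -(n * E ρ) := by linarith
        gcongr
      _ = (κ ^ ρ₀ * Real.exp (n * δ)) * (N ^ ρ * Real.exp (-(n * E ρ))) := by
        rw [Real.exp_add]; ring
      _ ≤ _ := by gcongr

lemma sup_lem {S : Set ℝ} (hS : S.Nonempty) {x C : ℝ} (hC : 0 ≤ C)
    (h : ∀ z ∈ S, x ≤ C * Real.exp (-z)) : x ≤ C * Real.exp (-sSup S) := by
  rcases le_or_gt x 0 with hx | hx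
  · exact hx.trans (by positivity)
  have hC' : 0 < C := by
    obtain ⟨z, hz⟩ := hS
    rcases hC.eq_or_lt with h0 | h0
    · have := h z hz; rw [← h0] at this; linarith
    · exact h0
  have : sSup S ≤ -Real.log (x / C) := by
    refine csSup_le hS fun z hz => ?_
    have h1 : x / C ≤ Real.exp (-z) := by rw [div_le_iff₀ hC']; linarith [h z hz]
    have := (Real.log_le_iff_le_exp (by positivity)).mpr h1
    linarith
  have h2 : Real.log (x / C) ≤ -sSup S := by linarith
  have h3 := (Real.log_le_iff_le_exp (by positivity)).mp h2
  rw [div_le_iff₀ hC'] at h3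
  linarith

lemma class_lower {A : Type} (s t : Finset A) (hst : s ⊆ t) (p : A → ℝ) (hp : ∀ a, 0 ≤ p a)
    {q z ρ : ℝ} (hq : 0 ≤ q) (hs : ∀ a ∈ s, p a = q) (hne : s.Nonempty) (hρ : 1 ≤ ρ) :
    q * (s.card : ℝ) ^ (1 + ρ) * Real.exp (-z) ≤
      Real.exp (-(z - (1 + ρ) * Real.log (∑ v ∈ t, p v ^ (1 / (1 + ρ))))) := by
  rcases hq.eq_or_lt with h0 | h0
  · rw [← h0]; simp only [zero_mul]; positivity
  have hc : (0 : ℝ) < s.card := by exact_mod_cast hne.card_pos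
  have h1 : (s.card : ℝ) * q ^ (1 / (1 + ρ)) ≤ ∑ v ∈ t, p v ^ (1 / (1 + ρ)) := by
    calc _ = ∑ v ∈ s, p v ^ (1 / (1 + ρ)) := by
          rw [← nsmul_eq_mul, ← Finset.sum_const]
          exact Finset.sum_congr rfl fun a ha => by rw [hs a ha]
      _ ≤ _ := Finset.sum_le_sum_of_subset_of_nonneg hst fun a _ _ => Real.rpow_nonneg (hp a) _
  have hpos : 0 < (s.card : ℝ) * q ^ (1 / (1 + ρ)) := by positivity
  have h2 := Real.rpow_le_rpow hpos.le h1 (by linarith : 0 ≤ 1 + ρ)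
  rw [Real.mul_rpow hc.le (by positivity), ← Real.rpow_mul h0.le,
    one_div_mul_cancel (by linarith), Real.rpow_one] at h2
  rw [neg_sub, sub_eq_add_neg, Real.exp_add]
  have h3 : Real.exp ((1 + ρ) * Real.log (∑ v ∈ t, p v ^ (1 / (1 + ρ)))) =
      (∑ v ∈ t, p v ^ (1 / (1 + ρ))) ^ (1 + ρ) := by
    rw [Real.rpow_def_of_pos (hpos.trans_le h1), mul_comm]
  rw [h3]
  gcongr
  linarith

lemma map_bound {V X Y : Type} [Fintype V] [Fintype X] [Fintype Y] {PV : V → ℝ}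
    (hPV : IsProbDist PV) {W : X → Y → ℝ} (hW : IsDMC W) {k n : ℕ}
    (f : (Fin k → V) → Fin n → X) :
    ∃ φ : (Fin n → Y) → Fin k → V, pErr PV W f φ ≤
      ∑ v, ∑ v', if v = v' then 0 else
        Real.sqrt (prodDist PV v * prodDist PV v') * Bn W 1 (f v) (f v') := by
  have hV : Nonempty V := by
    by_contra h
    rw [not_nonempty_iff] at h
    have := hPV.2
    simp at this
  have hp : ∀ v : Fin k → V, 0 ≤ prodDist PV v := fun v => Finset.prod_nonneg fun i _ => hPV.1 _
  have hw : ∀ (x : Fin n → X) (y : Fin n → Y), 0 ≤ Wn W x y :=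
    fun x y => Finset.prod_nonneg fun i _ => hW.1 _ _
  have hmax : ∀ y : Fin n → Y, ∃ v : Fin k → V, ∀ v', prodDist PV v' * Wn W (f v') y ≤
      prodDist PV v * Wn W (f v) y := fun y =>
    Finite.exists_max (fun v : Fin k → V => prodDist PV v * Wn W (f v) y)
  choose φ hφ using hmax
  refine ⟨φ, ?_⟩
  unfold pErr
  refine Finset.sum_le_sum fun v _ => ?_
  have h1 : ∀ v', (∑ y : Fin n → Y, if v = v' then 0 else
      Real.sqrt (prodDist PV v * prodDist PV v') * Real.sqrt (Wn W (f v) y * Wn W (f v') y)) ≤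
      if v = v' then 0 else
        Real.sqrt (prodDist PV v * prodDist PV v') * Bn W 1 (f v) (f v') := by
    intro v'
    split_ifs with h
    · simp
    · rw [← Finset.mul_sum]
      exact mul_le_mul_of_nonneg_left (bhat_prod_le hW _ _) (Real.sqrt_nonneg _)
  refine le_trans ?_ (Finset.sum_le_sum fun v' _ => h1 v')
  rw [Finset.sum_comm, Finset.mul_sum]
  have hnn : ∀ y v', 0 ≤ (if v = v' then 0 else
      Real.sqrt (prodDist PV v * prodDist PV v') * Real.sqrt (Wn W (f v) y * Wn W (f v') y)) := by
    intro y v'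
    split_ifs
    · exact le_rfl
    · positivity
  calc _ ≤ ∑ y ∈ Finset.univ.filter (fun y : Fin n → Y => φ y ≠ v), ∑ v', (if v = v' then 0 else
      Real.sqrt (prodDist PV v * prodDist PV v') * Real.sqrt (Wn W (f v) y * Wn W (f v') y)) := ?_
    _ ≤ _ := Finset.sum_le_univ_sum_of_nonneg fun y => Finset.sum_nonneg fun v' _ => hnn y v'
  refine Finset.sum_le_sum fun y hy => ?_
  have hy' : v ≠ φ y := (Finset.mem_filter.mp hy).2.symm
  refine le_trans ?_ (Finset.single_le_sum (fun v' _ => hnn y v') (Finset.mem_univ (φ y)))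
  rw [if_neg hy', ← Real.sqrt_mul (mul_nonneg (hp _) (hp _))]
  apply Real.le_sqrt_of_sq_le
  have a1 := hφ y v
  have a2 := mul_nonneg (hp v) (hw (f v) y)
  nlinarith

lemma greedy {A X Y : Type} [DecidableEq A] [Fintype X] [Fintype Y] (W : X → Y → ℝ) {n : ℕ}
    (hX : Nonempty (Fin n → X))
    (p : A → ℝ) (Nv : A → ℕ) (T : A → Finset (Fin n → X)) (Cst : A → ℝ)
    (hstep : ∀ (a : A) (s : Finset A) (f : A → Fin n → X), (∀ v ∈ s, Nv v ≤ Nv a) →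
      (∀ v ∈ s, f v ∈ T v) → ∃ x ∈ T a, ∑ v ∈ s, Real.sqrt (p v * p a) * Bn W 1 (f v) x ≤ Cst a)
    (s : Finset A) :
    ∃ f : A → Fin n → X, (∀ v ∈ s, f v ∈ T v) ∧
      (∑ v ∈ s, ∑ v' ∈ s, if v = v' then 0 else Real.sqrt (p v * p v') * Bn W 1 (f v) (f v')) ≤
        2 * ∑ a ∈ s, Cst a := by
  induction s using Finset.induction_on_max_value Nv with
  | empty => exact ⟨fun _ => hX.some, by simp, by simp⟩
  | insert a s ha hmax ih =>
    obtain ⟨f, hf, hle⟩ := ih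
    obtain ⟨x, hx, hxle⟩ := hstep a s f hmax hf
    have hne : ∀ v ∈ s, v ≠ a := fun v hv h => ha (h ▸ hv)
    have hfe : ∀ v ∈ s, Function.update f a x v = f v := fun v hv =>
      Function.update_of_ne (hne v hv) _ _
    refine ⟨Function.update f a x, ?_, ?_⟩
    · intro v hv
      rcases Finset.mem_insert.mp hv with rfl | hv
      · simpa using hx
      · rw [hfe v hv]; exact hf v hv
    · rw [Finset.sum_insert ha, Finset.sum_insert ha, Finset.sum_insert ha, if_pos rfl, zero_add]
      have e1 : (∑ v' ∈ s, if a = v' then 0 else Real.sqrt (p a * p v') *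
          Bn W 1 (Function.update f a x a) (Function.update f a x v')) =
          ∑ v ∈ s, Real.sqrt (p v * p a) * Bn W 1 (f v) x := by
        refine Finset.sum_congr rfl fun v hv => ?_
        rw [if_neg (hne v hv).symm, hfe v hv, Function.update_self, Bn_symm, mul_comm (p a)]
      have e2 : (∑ v ∈ s, ∑ v' ∈ insert a s, if v = v' then 0 else Real.sqrt (p v * p v') *
          Bn W 1 (Function.update f a x v) (Function.update f a x v')) =
          (∑ v ∈ s, Real.sqrt (p v * p a) * Bn W 1 (f v) x) +
          ∑ v ∈ s, ∑ v' ∈ s, if v = v' then 0 else Real.sqrt (p v * p v') *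
            Bn W 1 (f v) (f v') := by
        rw [← Finset.sum_add_distrib]
        refine Finset.sum_congr rfl fun v hv => ?_
        rw [Finset.sum_insert ha, if_neg (hne v hv), hfe v hv, Function.update_self]
        congr 1
        exact Finset.sum_congr rfl fun v' hv' => by rw [hfe v' hv']
      rw [e1, e2]
      linarith

lemma poly_exp (M : ℝ) (hM : 0 ≤ M) (e : ℕ) {c : ℝ} (hc : 0 < c) :
    ∃ n₀ : ℕ, ∀ n : ℕ, n₀ ≤ n → (M * ((n : ℝ) + 1)) ^ e ≤ Real.exp (c * n) := by
  have h := (isLittleO_pow_exp_pos_mul_atTop e hc).bound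
    (show (0 : ℝ) < ((2 * M + 1) ^ e)⁻¹ by positivity)
  have h2 := tendsto_natCast_atTop_atTop (R := ℝ) |>.eventually h
  obtain ⟨n₀, hn₀⟩ := Filter.eventually_atTop.mp h2
  refine ⟨max n₀ 1, fun n hn => ?_⟩
  have h3 := hn₀ n (le_of_max_le_left hn)
  have hn1 : (1 : ℝ) ≤ n := by exact_mod_cast le_of_max_le_right hn
  rw [Real.norm_of_nonneg (by positivity), Real.norm_of_nonneg (by positivity),
    inv_mul_eq_div, le_div_iff₀ (by positivity), ← mul_pow] at h3
  refine le_trans (pow_le_pow_left₀ (by positivity) ?_ e) h3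
  nlinarith

lemma pair_arith {p p' b N N' C G : ℝ} {E E' g g' : ℝ → ℝ} (hp : 0 ≤ p) (hp' : 0 ≤ p')
    (hb0 : 0 ≤ b) (hN : 1 ≤ N) (hNN : N ≤ N') (hC : 0 ≤ C)
    (hb : ∀ ρ, 1 ≤ ρ → b ≤ C * (N ^ ρ * Real.exp (-(E ρ))))
    (hb' : ∀ ρ, 1 ≤ ρ → b ≤ C * (N ^ ρ * Real.exp (-(E' ρ))))
    (hl : ∀ ρ, 1 ≤ ρ → p * N ^ (1 + ρ) * Real.exp (-(E ρ)) ≤ Real.exp (-(g ρ)))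
    (hl' : ∀ ρ, 1 ≤ ρ → p' * N' ^ (1 + ρ) * Real.exp (-(E' ρ)) ≤ Real.exp (-(g' ρ)))
    (hG : Real.exp (-sSup {z | ∃ ρ : ℝ, 1 ≤ ρ ∧ z = g ρ}) ≤ G)
    (hG' : Real.exp (-sSup {z | ∃ ρ : ℝ, 1 ≤ ρ ∧ z = g' ρ}) ≤ G) :
    Real.sqrt (p * p') * b * N' ≤ C * G := by
  have hG0 : 0 < G := (Real.exp_pos _).trans_le hG
  have hN0 : 0 < N := by linarith
  have hN'0 : 0 < N' := by linarith
  have key : ∀ ρ, 1 ≤ ρ → ∀ ρ', 1 ≤ ρ' →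
      p * p' * b ^ 2 * N' ^ 2 ≤ C ^ 2 * Real.exp (-(g ρ)) * Real.exp (-(g' ρ')) := by
    intro ρ hρ ρ' hρ'
    have e1 : N ^ (1 + ρ) = N * N ^ ρ := by rw [Real.rpow_add hN0, Real.rpow_one]
    have e2 : N' ^ (1 + ρ') = N' * N' * N' ^ (ρ' - 1) := by
      rw [show 1 + ρ' = 1 + 1 + (ρ' - 1) by ring, Real.rpow_add hN'0, Real.rpow_add hN'0,
        Real.rpow_one]
    have e3 : N ^ ρ' = N * N ^ (ρ' - 1) := by
      rw [Real.rpow_sub_one hN0.ne']; field_simp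
    have e4 : N ^ (ρ' - 1) ≤ N' ^ (ρ' - 1) := Real.rpow_le_rpow hN0.le hNN (by linarith)
    calc p * p' * b ^ 2 * N' ^ 2 = p * p' * N' ^ 2 * (b * b) := by ring
      _ ≤ p * p' * N' ^ 2 * ((C * (N ^ ρ * Real.exp (-(E ρ)))) *
            (C * (N ^ ρ' * Real.exp (-(E' ρ'))))) := by
          have := mul_le_mul (hb ρ hρ) (hb' ρ' hρ') hb0 (by positivity)
          gcongr
      _ = C ^ 2 * (p * N ^ (1 + ρ) * Real.exp (-(E ρ))) *
            (p' * (N' * N' * N ^ (ρ' - 1)) * Real.exp (-(E' ρ'))) := by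
          rw [e1, e3]; ring
      _ ≤ C ^ 2 * (p * N ^ (1 + ρ) * Real.exp (-(E ρ))) *
            (p' * (N' * N' * N' ^ (ρ' - 1)) * Real.exp (-(E' ρ'))) := by
          gcongr
      _ = C ^ 2 * (p * N ^ (1 + ρ) * Real.exp (-(E ρ))) *
            (p' * N' ^ (1 + ρ') * Real.exp (-(E' ρ'))) := by rw [e2]
      _ ≤ _ := by
          have h1 := hl ρ hρ
          have h2 := hl' ρ' hρ'
          gcongr
  have k2 : ∀ ρ, 1 ≤ ρ → p * p' * b ^ 2 * N' ^ 2 ≤ C ^ 2 * G * Real.exp (-(g ρ)) := by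
    intro ρ hρ
    have h := sup_lem (S := {z | ∃ ρ : ℝ, 1 ≤ ρ ∧ z = g' ρ}) ⟨_, 1, le_rfl, rfl⟩
      (x := p * p' * b ^ 2 * N' ^ 2) (C := C ^ 2 * Real.exp (-(g ρ))) (by positivity)
      (by rintro z ⟨ρ', hρ', rfl⟩; exact key ρ hρ ρ' hρ')
    refine h.trans ?_
    calc _ ≤ C ^ 2 * Real.exp (-(g ρ)) * G := by gcongr
      _ = _ := by ring
  have k3 : p * p' * b ^ 2 * N' ^ 2 ≤ C ^ 2 * G * G := by
    have h := sup_lem (S := {z | ∃ ρ : ℝ, 1 ≤ ρ ∧ z = g ρ}) ⟨_, 1, le_rfl, rfl⟩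
      (x := p * p' * b ^ 2 * N' ^ 2) (C := C ^ 2 * G) (by positivity)
      (by rintro z ⟨ρ, hρ, rfl⟩; exact k2 ρ hρ)
    refine h.trans ?_
    gcongr
  refine le_of_sq_le_sq ?_ (by positivity)
  rw [mul_pow, mul_pow, Real.sq_sqrt (mul_nonneg hp hp')]
  linarith

set_option maxHeartbeats 400000 in
lemma main_fixed {V X Y : Type} [Fintype V] [Fintype X] [Fintype Y]
    (PV : V → ℝ) (hPV : IsProbDist PV) (W : X → Y → ℝ) (hW : IsDMC W)
    {n k m : ℕ} (hn : 0 < n) (cls : (Fin k → V) → Fin m) (Qc : Fin m → X → ℝ)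
    (hadm : AdmissiblePartition n cls Qc) {D ρ₀ C : ℝ} (hD : ∀ x x', dB W x x' ≤ D)
    (hρ₀ : 1 ≤ ρ₀)
    (hC : ((((k : ℝ) + 1) ^ Fintype.card V * ((n : ℝ) + 1) ^ Fintype.card (X × X)) *
      ((n : ℝ) + 1) ^ Fintype.card X) ^ ρ₀ * Real.exp (n * (D ^ 2 / ρ₀)) ≤ C) :
    ∃ (f : (Fin k → V) → Fin n → X) (φ : (Fin n → Y) → Fin k → V),
      pErr PV W f φ ≤ (2 * (((k : ℝ) + 1) ^ Fintype.card V) ^ 2 * C) *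
        ∑ c : Fin m, Real.exp (-(sSup { z | ∃ ρ : ℝ, 1 ≤ ρ ∧
                z = (n : ℝ) * Ex' W (Qc c) ρ -
                  (1 + ρ) * Real.log (∑ v ∈ Finset.univ.filter
                    (fun v : Fin k → V => cls v = c),
                      prodDist PV v ^ (1 / (1 + ρ))) })) := by
  obtain ⟨hcls, hty, -⟩ := hadm
  set G : ℝ := ∑ c : Fin m, Real.exp (-(sSup { z | ∃ ρ : ℝ, 1 ≤ ρ ∧
                z = (n : ℝ) * Ex' W (Qc c) ρ -
                  (1 + ρ) * Real.log (∑ v ∈ Finset.univ.filter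
                    (fun v : Fin k → V => cls v = c),
                      prodDist PV v ^ (1 / (1 + ρ))) })) with hGdef
  have hGc : ∀ c : Fin m, Real.exp (-(sSup { z | ∃ ρ : ℝ, 1 ≤ ρ ∧
                z = (n : ℝ) * Ex' W (Qc c) ρ -
                  (1 + ρ) * Real.log (∑ v ∈ Finset.univ.filter
                    (fun v : Fin k → V => cls v = c),
                      prodDist PV v ^ (1 / (1 + ρ))) })) ≤ G := fun c =>
    Finset.single_le_sum (f := fun c : Fin m => Real.exp (-(sSup { z | ∃ ρ : ℝ, 1 ≤ ρ ∧
                z = (n : ℝ) * Ex' W (Qc c) ρ -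
                  (1 + ρ) * Real.log (∑ v ∈ Finset.univ.filter
                    (fun v : Fin k → V => cls v = c),
                      prodDist PV v ^ (1 / (1 + ρ))) }))) (fun c _ => (Real.exp_pos _).le)
      (Finset.mem_univ c)
  have hG0 : 0 ≤ G := Finset.sum_nonneg fun c _ => (Real.exp_pos _).le
  set K : ℝ := ((k : ℝ) + 1) ^ Fintype.card V * ((n : ℝ) + 1) ^ Fintype.card (X × X) with hK
  set P : ℝ := ((n : ℝ) + 1) ^ Fintype.card X with hP
  have h1k : (1 : ℝ) ≤ (k : ℝ) + 1 := by linarith [Nat.cast_nonneg (α := ℝ) k]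
  have h1n : (1 : ℝ) ≤ (n : ℝ) + 1 := by linarith [Nat.cast_nonneg (α := ℝ) n]
  have hK1 : 1 ≤ K := one_le_mul_of_one_le_of_one_le (one_le_pow₀ h1k) (one_le_pow₀ h1n)
  have hP1 : 1 ≤ P := one_le_pow₀ h1n
  have hKP : 1 ≤ K * P := one_le_mul_of_one_le_of_one_le hK1 hP1
  have hρ00 : 0 < ρ₀ := by linarith
  have hC0 : 0 ≤ C := le_trans (by positivity) hC
  have hp : ∀ v : Fin k → V, 0 ≤ prodDist PV v := fun v => Finset.prod_nonneg fun i _ => hPV.1 _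
  have hpty : ∀ v w : Fin k → V, cntF v = cntF w → prodDist PV v = prodDist PV w := by
    intro v w h
    unfold prodDist
    rw [prod_cntF v, prod_cntF w, h]
  have hclsty : ∀ v w : Fin k → V, cntF v = cntF w → cls v = cls w := fun v w h =>
    hcls v w (empDist_eq_of_cntF h)
  let F : (Fin k → V) → Finset (Fin k → V) := fun v => Finset.univ.filter fun w => cntF w = cntF v
  have hFmem : ∀ v, v ∈ F v := fun v => by simp [F]
  let Nv : (Fin k → V) → ℕ := fun v => (F v).card
  have hNv : ∀ v, 1 ≤ Nv v := fun v => Finset.card_pos.mpr ⟨v, hFmem v⟩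
  have hQprob : ∀ c, IsProbDist (Qc c) := by
    intro c
    obtain ⟨x, hx⟩ := hty c
    rw [← hx]; exact empDist_prob hn x
  have hTne : ∀ c, (typeClass n (Qc c)).Nonempty := by
    intro c
    obtain ⟨x, hx⟩ := hty c
    exact ⟨x, by simp [typeClass, hx]⟩
  have hV : Nonempty V := by
    by_contra h
    rw [not_nonempty_iff] at h
    have := hPV.2
    simp at this
  have hX : Nonempty (Fin n → X) := by
    obtain ⟨x, -⟩ := hTne (cls fun _ => hV.some)
    exact ⟨x⟩
  have hΛ : (Fintype.card (V → Fin (k + 1)) : ℝ) = ((k : ℝ) + 1) ^ Fintype.card V := by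
    rw [Fintype.card_fun, Fintype.card_fin]; push_cast; rfl
  set L : ℝ := ((k : ℝ) + 1) ^ Fintype.card V with hL
  have hlow : ∀ (v : Fin k → V) (ρ : ℝ), 1 ≤ ρ →
      prodDist PV v * (Nv v : ℝ) ^ (1 + ρ) * Real.exp (-((n : ℝ) * Ex' W (Qc (cls v)) ρ)) ≤
      Real.exp (-((n : ℝ) * Ex' W (Qc (cls v)) ρ -
                  (1 + ρ) * Real.log (∑ w ∈ Finset.univ.filter
                    (fun w : Fin k → V => cls w = cls v),
                      prodDist PV w ^ (1 / (1 + ρ))))) := by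
    intro v ρ hρ
    refine class_lower (F v) _ ?_ (prodDist PV) hp (hp v) ?_ ⟨v, hFmem v⟩ hρ
    · intro w hw
      simp only [F, Finset.mem_filter, Finset.mem_univ, true_and] at hw ⊢
      exact hclsty _ _ hw
    · intro w hw
      exact hpty _ _ (Finset.mem_filter.mp hw).2
  obtain ⟨f, -, hf⟩ := greedy W hX (prodDist PV) Nv (fun v => typeClass n (Qc (cls v)))
    (fun a => L * (C * G / Nv a)) (by
      intro a s f hmax hmem
      obtain ⟨x, hx, hstep⟩ := step1 W (typeClass n (Qc (cls a))) (hTne _) s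
        (cntF : (Fin k → V) → V → Fin (k + 1)) f
      rw [hΛ, ← hK] at hstep
      refine ⟨x, hx, ?_⟩
      have hNa : (0 : ℝ) < Nv a := by exact_mod_cast hNv a
      rw [← Finset.sum_fiberwise s (cntF : (Fin k → V) → V → Fin (k + 1)), ← hΛ, ← nsmul_eq_mul,
        ← Finset.card_univ, ← Finset.sum_const]
      refine Finset.sum_le_sum fun l _ => ?_
      rcases (s.filter (fun v => cntF v = l)).eq_empty_or_nonempty with he | ⟨w, hw⟩
      · rw [he, Finset.sum_empty]; positivity
      obtain ⟨hws, rfl⟩ := Finset.mem_filter.mp hw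
      have hin : ∀ v ∈ s.filter (fun v => cntF v = cntF w), v ∈ s ∧ cntF v = cntF w :=
        fun v hv => Finset.mem_filter.mp hv
      rw [Finset.sum_congr rfl fun v hv => by rw [hpty v w (hin v hv).2], ← Finset.mul_sum,
        le_div_iff₀ hNa]
      have hcard : ((s.filter (fun v => cntF v = cntF w)).card : ℝ) ≤ Nv w := by
        have : (s.filter (fun v => cntF v = cntF w)).card ≤ Nv w :=
          Finset.card_le_card (Finset.filter_subset_filter _ (Finset.subset_univ _))
        exact_mod_cast this
      have hfw : ∀ v ∈ s.filter (fun v => cntF v = cntF w), f v ∈ typeClass n (Qc (cls w)) := by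
        intro v hv
        rw [← hclsty v w (hin v hv).2]
        exact hmem v (hin v hv).1
      have hδ : 0 ≤ D ^ 2 / ρ₀ := by positivity
      have hNw : (1 : ℝ) ≤ Nv w := by exact_mod_cast hNv w
      refine pair_arith (N := Nv w) (E := fun ρ => n * Ex' W (Qc (cls w)) ρ)
        (E' := fun ρ => n * Ex' W (Qc (cls a)) ρ) (hp w) (hp a)
        (Finset.sum_nonneg fun v _ => (Bn_pos _ _ _ _).le) hNw
        (by exact_mod_cast hmax w hws) hC0 ?_ ?_ (hlow w) (hlow a) (hGc _) (hGc _)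
      · refine all_rho (E := fun ρ => Ex' W (Qc (cls w)) ρ) hKP hNw hρ₀ hδ
          (fun ρ hρ => Ex'_growth hW (hQprob _) hρ hρ₀ hD) hC ?_
        intro ρ hρ
        exact step2 W _ (hTne (cls a)) _ f x hρ (by linarith) (by linarith) hcard
          (hstep (cntF w) ρ) (fun v hv => avg_bound hW hn hρ (hfw v hv) (hty _))
      · refine all_rho (E := fun ρ => Ex' W (Qc (cls a)) ρ) hKP hNw hρ₀ hδ
          (fun ρ hρ => Ex'_growth hW (hQprob _) hρ hρ₀ hD) hC ?_
        intro ρ hρ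
        exact step2 W _ (hTne (cls a)) _ f x hρ (by linarith) (by linarith) hcard
          (hstep (cntF w) ρ) (fun v hv => avg_bound' hW hn hρ (hfw v hv) (hty _)))
    Finset.univ
  obtain ⟨φ, hφ⟩ := map_bound hPV hW f
  refine ⟨f, φ, hφ.trans (hf.trans ?_)⟩
  have hsum : ∑ a : Fin k → V, (1 : ℝ) / Nv a ≤ L := by
    rw [← Finset.sum_fiberwise Finset.univ (cntF : (Fin k → V) → V → Fin (k + 1)), ← hΛ]
    calc _ ≤ ∑ l : V → Fin (k + 1), (1 : ℝ) := ?_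
      _ = _ := by simp
    refine Finset.sum_le_sum fun l _ => ?_
    rcases (Finset.univ.filter (fun v : Fin k → V => cntF v = l)).eq_empty_or_nonempty
      with he | ⟨w, hw⟩
    · rw [he, Finset.sum_empty]; norm_num
    obtain ⟨-, rfl⟩ := Finset.mem_filter.mp hw
    have hNw : (0 : ℝ) < Nv w := by exact_mod_cast hNv w
    have : ∀ v ∈ Finset.univ.filter (fun v : Fin k → V => cntF v = cntF w),
        (1 : ℝ) / Nv v = 1 / Nv w := by
      intro v hv
      have h := (Finset.mem_filter.mp hv).2
      simp only [Nv, F, h]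
    rw [Finset.sum_congr rfl this, Finset.sum_const, nsmul_eq_mul]
    change (Nv w : ℝ) * (1 / Nv w) ≤ 1
    rw [mul_one_div_cancel hNw.ne']
  clear_value G
  have e : ∑ a : Fin k → V, L * (C * G / Nv a) = L * C * G * ∑ a : Fin k → V, (1 : ℝ) / Nv a := by
    rw [Finset.mul_sum]
    exact Finset.sum_congr rfl fun a _ => by ring
  rw [e]
  calc 2 * (L * C * G * ∑ a : Fin k → V, (1 : ℝ) / Nv a) ≤ 2 * (L * C * G * L) := by
        gcongr
    _ = _ := by ring

/-- Corollary 1: for every admissible partition there exists a code with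
`p_e ≤ e^{nε} Σ_c exp(-sup_{ρ ≥ 1}{n E'_x(Q_c, ρ) - E_s^{(c)}(ρ, P^k)})`, where
`E_s^{(c)}(ρ, P^k) = (1+ρ) log Σ_{v ∈ 𝒜_c} P^k(v)^{1/(1+ρ)}`. -/
theorem stmt4 {V X Y : Type} [Fintype V] [Fintype X] [Fintype Y]
    (PV : V → ℝ) (hPV : IsProbDist PV) (W : X → Y → ℝ) (hW : IsDMC W)
    (t : ℝ) (ht : 0 < t) (ε : ℝ) (hε : 0 < ε) :
    ∃ n₀ : ℕ, ∀ n : ℕ, n₀ ≤ n →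
      ∀ (m : ℕ) (cls : (Fin ⌊t * (n : ℝ)⌋₊ → V) → Fin m) (Qc : Fin m → X → ℝ),
        AdmissiblePartition n cls Qc →
        ∃ (f : (Fin ⌊t * (n : ℝ)⌋₊ → V) → Fin n → X)
          (φ : (Fin n → Y) → Fin ⌊t * (n : ℝ)⌋₊ → V),
          pErr PV W f φ ≤ Real.exp ((n : ℝ) * ε) *
            ∑ c : Fin m,
              Real.exp (-(sSup { z | ∃ ρ : ℝ, 1 ≤ ρ ∧
                z = (n : ℝ) * Ex' W (Qc c) ρ -
                  (1 + ρ) * Real.log (∑ v ∈ Finset.univ.filter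
                    (fun v : Fin ⌊t * (n : ℝ)⌋₊ → V => cls v = c),
                      prodDist PV v ^ (1 / (1 + ρ))) })) := by
  set D : ℝ := ∑ p : X × X, dB W p.1 p.2 with hDdef
  have hD : ∀ x x', dB W x x' ≤ D := fun x x' =>
    Finset.single_le_sum (f := fun p : X × X => dB W p.1 p.2) (fun p _ => dB_nonneg hW _ _)
      (Finset.mem_univ (x, x'))
  obtain ⟨r, hr⟩ := exists_nat_ge (4 * D ^ 2 / ε)
  set R : ℕ := r + 1
  set e : ℕ := Fintype.card V + Fintype.card (X × X) + Fintype.card X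
  obtain ⟨n₁, hn₁⟩ := poly_exp (2 * (t + 1)) (by positivity) (e * R) (c := ε / 4) (by positivity)
  obtain ⟨n₂, hn₂⟩ := poly_exp (2 * (t + 1)) (by positivity) (Fintype.card V * 2 + 1) (c := ε / 4)
    (by positivity)
  refine ⟨max 1 (max n₁ n₂), fun n hn m cls Qc hadm => ?_⟩
  have hn0 : 0 < n := le_of_max_le_left hn
  have hA := hn₁ n (le_of_max_le_left (le_of_max_le_right hn))
  have hB := hn₂ n (le_of_max_le_right (le_of_max_le_right hn))
  have hnR : (0 : ℝ) < n := by exact_mod_cast hn0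
  set B : ℝ := 2 * (t + 1) * ((n : ℝ) + 1) with hBdef
  have hk : ((⌊t * (n : ℝ)⌋₊ : ℕ) : ℝ) + 1 ≤ B := by
    have := Nat.floor_le (show 0 ≤ t * (n : ℝ) by positivity)
    rw [hBdef]; nlinarith
  have hnB : (n : ℝ) + 1 ≤ B := by rw [hBdef]; nlinarith
  have h2B : 2 ≤ B := by rw [hBdef]; nlinarith
  have hB0 : 0 ≤ B := by linarith
  have hR1 : (1 : ℝ) ≤ (R : ℝ) := by simp [R]
  have hdelta : D ^ 2 / (R : ℝ) ≤ ε / 4 := by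
    rw [div_le_iff₀ (by linarith)]
    rw [div_le_iff₀ hε] at hr
    have : (R : ℝ) = r + 1 := by simp [R]
    rw [this]; nlinarith
  obtain ⟨f, φ, h⟩ := main_fixed PV hPV W hW hn0 cls Qc hadm hD hR1
    (C := Real.exp (n * (ε / 2))) (by
      rw [Real.rpow_natCast]
      calc _ ≤ (B ^ Fintype.card V * B ^ Fintype.card (X × X) * B ^ Fintype.card X) ^ R *
            Real.exp (n * (ε / 4)) := by gcongr
        _ = B ^ (e * R) * Real.exp (n * (ε / 4)) := by rw [← pow_add, ← pow_add, ← pow_mul]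
        _ ≤ Real.exp (ε / 4 * n) * Real.exp (n * (ε / 4)) := by gcongr
        _ = _ := by rw [← Real.exp_add]; congr 1; ring)
  refine ⟨f, φ, h.trans ?_⟩
  refine mul_le_mul_of_nonneg_right ?_ (Finset.sum_nonneg fun c _ => (Real.exp_pos _).le)
  calc _ ≤ (B * (B ^ Fintype.card V) ^ 2) * Real.exp (n * (ε / 2)) := by gcongr
    _ = B ^ (Fintype.card V * 2 + 1) * Real.exp (n * (ε / 2)) := by rw [← pow_mul]; ring
    _ ≤ Real.exp (ε / 4 * n) * Real.exp (n * (ε / 2)) := by gcongr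
    _ = Real.exp (n * (3 * ε / 4)) := by rw [← Real.exp_add]; congr 1; ring
    _ ≤ _ := by gcongr; linarith

end
end

section
/- For every probability distribution P on the finite alphabet 𝒱 with P absolutely continuous with respect to P_V, and every λ > 0, it holds that λ·H(P) − D(P‖P_V) ≤ E_s(λ, P_V). -/
open scoped Classical BigOperators

noncomputable section

/-- for every distribution `P ≪ P_V` and every `λ > 0`,
`λ H(P) - D(P‖P_V) ≤ E_s(λ, P_V)`. -/
theorem stmt14 {V : Type} [Fintype V]
    (PV : V → ℝ) (hPV : IsProbDist PV)
    (P : V → ℝ) (hP : IsProbDist P) (hac : ∀ v, PV v = 0 → P v = 0)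
    (lam : ℝ) (hlam : 0 < lam) :
    lam * entH P - KL P PV ≤ Es PV lam := by
  obtain ⟨hPV0, hPV1⟩ := hPV
  obtain ⟨hP0, hP1⟩ := hP
  have hl : (0:ℝ) < 1 + lam := by linarith
  have hnn : ∀ v, 0 ≤ PV v ^ (1 / (1 + lam)) := fun v => Real.rpow_nonneg (hPV0 v) _
  have hS : 0 < ∑ v, PV v ^ (1 / (1 + lam)) := by
    obtain ⟨v, hv⟩ : ∃ v, PV v ≠ 0 := by
      by_contra h
      push Not at h
      simp [h] at hPV1
    exact Finset.sum_pos' (fun v _ => hnn v)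
      ⟨v, Finset.mem_univ v, Real.rpow_pos_of_pos (lt_of_le_of_ne (hPV0 v) (Ne.symm hv)) _⟩
  unfold entH KL Es
  set S := ∑ v, PV v ^ (1 / (1 + lam)) with hSdef
  have key : ∀ v, -lam * (P v * Real.log (P v)) - P v * Real.log (P v / PV v) ≤
      (1 + lam) * (P v * Real.log S + PV v ^ (1 / (1 + lam)) / S - P v) := by
    intro v
    rcases (hP0 v).eq_or_lt with h | h
    · rw [← h]
      have := mul_nonneg hl.le (div_nonneg (hnn v) hS.le)
      simpa using this
    · have hv : 0 < PV v :=
        lt_of_le_of_ne (hPV0 v) (fun h0 => h.ne' (hac v h0.symm))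
      have ht : 0 < PV v ^ (1 / (1 + lam)) := Real.rpow_pos_of_pos hv _
      have h1 := Real.log_le_sub_one_of_pos (div_pos ht (mul_pos h hS))
      rw [Real.log_div ht.ne' (mul_pos h hS).ne', Real.log_mul h.ne' hS.ne',
        Real.log_rpow hv] at h1
      have h2 := mul_le_mul_of_nonneg_left h1 (mul_pos hl h).le
      rw [Real.log_div h.ne' hv.ne']
      have e1 : (1 + lam) * P v * (PV v ^ (1 / (1 + lam)) / (P v * S) - 1)
          = (1 + lam) * (PV v ^ (1 / (1 + lam)) / S - P v) := by
        field_simp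
      have e2 : (1 + lam) * P v * (1 / (1 + lam) * Real.log (PV v)
            - (Real.log (P v) + Real.log S))
          = P v * Real.log (PV v) - (1 + lam) * P v * (Real.log (P v) + Real.log S) := by
        field_simp
      rw [e1, e2] at h2
      linarith
  have hsum := Finset.sum_le_sum (fun v (_ : v ∈ Finset.univ) => key v)
  rw [← Finset.mul_sum, Finset.sum_sub_distrib, Finset.sum_sub_distrib, Finset.sum_add_distrib,
    ← Finset.mul_sum, ← Finset.sum_mul, ← Finset.sum_div, hP1, ← hSdef, div_self hS.ne'] at hsum
  linarith

end
end

section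
/- Let Q_a, Q_b ∈ 𝒫ₙ(𝒳) be compositions, let x ∈ T^n(Q_a) be fixed, let X̄ = (X̄₁, …, X̄ₙ) be uniformly distributed on the type class T^n(Q_b), and let ρ > 0. Then 𝔼[ ∏_{l=1}^{n} e^{−d_B(x_l, X̄_l)/ρ} ] ≤ (n+1)^{|𝒳|} · exp( n · Σ_{x'∈𝒳} Q_a(x') · log Σ_{x̄∈𝒳} Q_b(x̄) e^{−d_B(x', x̄)/ρ} ). -/
open scoped Classical BigOperators

noncomputable section

def cntS {X : Type} {n : ℕ} (v : Fin n → X) (a : X) : ℕ :=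
  (Finset.univ.filter fun i => v i = a).card

lemma exists_perm_of_cntS {X : Type} {n : ℕ} (u v : Fin n → X) (h : cntS v = cntS u) :
    ∃ τ : Equiv.Perm (Fin n), v = u ∘ τ := by
  have e : ∀ c, Nonempty ({a // v a = c} ≃ {b // u b = c}) := by
    intro c
    refine ⟨Fintype.equivOfCardEq ?_⟩
    rw [Fintype.card_subtype, Fintype.card_subtype]
    exact congrFun h c
  refine ⟨Equiv.ofFiberEquiv (fun c => (e c).some), ?_⟩
  funext a
  exact (Equiv.ofFiberEquiv_map _ a).symm

lemma cntS_comp {X : Type} {n : ℕ} (u : Fin n → X) (τ : Equiv.Perm (Fin n)) :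
    cntS (u ∘ τ) = cntS u := by
  funext a
  unfold cntS
  refine Finset.card_bij (fun i _ => τ i) ?_ ?_ ?_
  · intro i hi
    simpa using hi
  · intro i _ j _ hij
    exact τ.injective hij
  · intro b hb
    refine ⟨τ.symm b, ?_, by simp⟩
    simpa using hb

lemma card_T_mul {X : Type} [Fintype X] {n : ℕ} (u : Fin n → X) :
    (Finset.univ.filter fun v : Fin n → X => cntS v = cntS u).card * ∏ a, (cntS u a).factorial
      = n.factorial := by
  have hs := DomMulAct.stabilizer_card u
  have h1 : Fintype.card {g : Equiv.Perm (Fin n) // u ∘ g = u} = ∏ a, (cntS u a).factorial := by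
    convert hs using 3
    rw [Fintype.card_subtype]
    rfl
  have h2 : n.factorial = (Finset.univ : Finset (Equiv.Perm (Fin n))).card := by
    rw [Finset.card_univ, Fintype.card_perm, Fintype.card_fin]
  rw [h2, Finset.card_eq_sum_card_fiberwise (f := fun σ : Equiv.Perm (Fin n) => u ∘ σ)
    (t := Finset.univ.filter fun v : Fin n → X => cntS v = cntS u)
    (fun σ _ => by simp [cntS_comp])]
  symm
  rw [← smul_eq_mul]
  apply Finset.sum_const_nat
  intro v hv
  obtain ⟨τ, rfl⟩ := exists_perm_of_cntS u v (by simpa using hv)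
  rw [← h1, Fintype.card_subtype]
  refine Finset.card_bij (fun σ _ => σ * τ⁻¹) ?_ ?_ ?_
  · intro σ hσ
    simp only [Finset.mem_filter, Finset.mem_univ, true_and] at hσ ⊢
    funext i
    have := congrFun hσ (τ⁻¹ i)
    simpa using this
  · intro σ _ σ' _ h
    exact mul_right_cancel h
  · intro g hg
    refine ⟨g * τ, ?_, by simp⟩
    simp only [Finset.mem_filter, Finset.mem_univ, true_and] at hg ⊢
    funext i
    have := congrFun hg (τ i)
    simpa using this

lemma fact_pow_le (m k : ℕ) : m.factorial * m ^ k ≤ k.factorial * m ^ m := by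
  rcases le_total m k with h | h
  · have := Nat.factorial_mul_pow_sub_le_factorial h
    calc m.factorial * m ^ k = (m.factorial * m ^ (k - m)) * m ^ m := by
          rw [mul_assoc, ← pow_add, Nat.sub_add_cancel h]
      _ ≤ _ := Nat.mul_le_mul_right _ this
  · have h1 : m.factorial ≤ k.factorial * m ^ (m - k) := by
      have := Nat.factorial_mul_descFactorial (Nat.sub_le m k)
      rw [Nat.sub_sub_self h] at this
      rw [← this]
      exact Nat.mul_le_mul_left _ (Nat.descFactorial_le_pow _ _)
    calc m.factorial * m ^ k ≤ (k.factorial * m ^ (m - k)) * m ^ k := Nat.mul_le_mul_right _ h1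
      _ = _ := by rw [mul_assoc, ← pow_add, Nat.sub_add_cancel h]

lemma prod_seq_eq {X M : Type} [Fintype X] [CommMonoid M] {n : ℕ} (f : X → M) (v : Fin n → X) :
    ∏ i, f (v i) = ∏ a, f a ^ cntS v a := by
  rw [← Finset.prod_fiberwise Finset.univ v (fun i => f (v i))]
  refine Finset.prod_congr rfl fun a _ => ?_
  unfold cntS
  rw [← Finset.prod_const]
  refine Finset.prod_congr ?_ ?_
  · ext; simp
  · intro i hi
    simp only [Finset.mem_filter] at hi
    rw [hi.2]

lemma sum_cntS {X : Type} [Fintype X] {n : ℕ} (v : Fin n → X) : ∑ a, cntS v a = n := by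
  have := Finset.card_eq_sum_card_fiberwise (f := v) (s := Finset.univ) (t := Finset.univ)
    (fun _ _ => by simp)
  rw [Finset.card_univ, Fintype.card_fin] at this
  exact this.symm

lemma T_max {X : Type} [Fintype X] {n : ℕ} (u v : Fin n → X) :
    (Finset.univ.filter fun w : Fin n → X => cntS w = cntS v).card * ∏ a, cntS u a ^ cntS v a
    ≤ (Finset.univ.filter fun w : Fin n → X => cntS w = cntS u).card *
      ∏ a, cntS u a ^ cntS u a := by
  have hu := card_T_mul u
  have hv := card_T_mul v
  set A := (Finset.univ.filter fun w : Fin n → X => cntS w = cntS v).card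
  set B := (Finset.univ.filter fun w : Fin n → X => cntS w = cntS u).card
  have key : (∏ a, (cntS u a).factorial) * ∏ a, cntS u a ^ cntS v a ≤
      (∏ a, (cntS v a).factorial) * ∏ a, cntS u a ^ cntS u a := by
    rw [← Finset.prod_mul_distrib, ← Finset.prod_mul_distrib]
    exact Finset.prod_le_prod' fun a _ => fact_pow_le _ _
  have pu : 0 < ∏ a, (cntS u a).factorial := Finset.prod_pos fun a _ => Nat.factorial_pos _
  have pv : 0 < ∏ a, (cntS v a).factorial := Finset.prod_pos fun a _ => Nat.factorial_pos _
  generalize (∏ a, (cntS u a).factorial) = fu at *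
  generalize (∏ a, (cntS v a).factorial) = fv at *
  generalize (∏ a, cntS u a ^ cntS v a) = p at *
  generalize (∏ a, cntS u a ^ cntS u a) = q at *
  refine Nat.le_of_mul_le_mul_left ?_ (Nat.mul_pos pu pv)
  calc fu * fv * (A * p) = (A * fv) * (fu * p) := by ring
    _ ≤ (A * fv) * (fv * q) := Nat.mul_le_mul_left _ key
    _ = fu * fv * (B * q) := by rw [hv, ← hu]; ring

lemma T_lower {X : Type} [Fintype X] {n : ℕ} (u : Fin n → X) :
    n ^ n ≤ (n + 1) ^ Fintype.card X *
      ((Finset.univ.filter fun w : Fin n → X => cntS w = cntS u).card *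
      ∏ a, cntS u a ^ cntS u a) := by
  have h0 : n ^ n = ∑ v : Fin n → X, ∏ i, cntS u (v i) := by
    rw [← Fintype.prod_sum (fun (_ : Fin n) (a : X) => cntS u a)]
    simp [sum_cntS]
  rw [h0]
  have h1 : ∀ v ∈ (Finset.univ : Finset (Fin n → X)), cntS v ∈ 
      Fintype.piFinset (fun _ : X => Finset.range (n + 1)) := by
    intro v _
    rw [Fintype.mem_piFinset]
    intro a
    rw [Finset.mem_range, Nat.lt_succ_iff]
    exact (Finset.card_le_univ _).trans (by simp)
  rw [← Finset.sum_fiberwise_of_maps_to h1]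
  have hc : (Fintype.piFinset (fun _ : X => Finset.range (n + 1))).card
      = (n + 1) ^ Fintype.card X := by
    simp [Fintype.card_piFinset]
  rw [← hc, ← smul_eq_mul]
  refine Finset.sum_le_card_nsmul _ _ _ ?_
  intro k _
  by_cases hk : ∃ v : Fin n → X, cntS v = k
  · obtain ⟨v, rfl⟩ := hk
    refine le_trans (le_of_eq ?_) (T_max u v)
    rw [← smul_eq_mul, ← Finset.sum_const]
    refine Finset.sum_congr rfl fun w hw => ?_
    rw [prod_seq_eq, (Finset.mem_filter.1 hw).2]
  · rw [Finset.filter_false_of_mem]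
    · simp
    · intro v _ hv
      exact hk ⟨v, hv⟩

lemma main_bound {X : Type} [Fintype X] {n : ℕ} (hn : 0 < n) (w : X → X → ℝ)
    (hw : ∀ a b, 0 < w a b) (x u : Fin n → X) :
    (1 / ((typeClass n (empDist u)).card : ℝ)) *
        ∑ xb ∈ typeClass n (empDist u), ∏ l, w (x l) (xb l)
      ≤ ((n : ℝ) + 1) ^ Fintype.card X *
        Real.exp ((n : ℝ) * ∑ x' : X, empDist x x' *
          Real.log (∑ xbar : X, empDist u xbar * w x' xbar)) := by
  have hn' : (0 : ℝ) < n := by exact_mod_cast hn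
  have hE : ∀ v : Fin n → X, ∀ a, empDist v a = (cntS v a : ℝ) / n := fun v a => rfl
  have hT : typeClass n (empDist u) = Finset.univ.filter fun v : Fin n → X => cntS v = cntS u := by
    unfold typeClass
    refine Finset.filter_congr fun v _ => ?_
    constructor
    · intro h
      funext a
      have := congrFun h a
      rw [hE, hE, div_left_inj' hn'.ne'] at this
      exact_mod_cast this
    · intro h
      funext a
      rw [hE, hE, h]
  rw [hT]
  have hl := T_lower u
  set T := Finset.univ.filter fun v : Fin n → X => cntS v = cntS u with hTdef
  set S : X → ℝ := fun a => ∑ b, empDist u b * w a b with hS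
  have hSpos : ∀ a, 0 < S a := by
    intro a
    refine Finset.sum_pos' (fun b _ => ?_) ⟨u ⟨0, hn⟩, Finset.mem_univ _, ?_⟩
    · rw [hE]; exact mul_nonneg (by positivity) (hw _ _).le
    · rw [hE]
      refine mul_pos (div_pos ?_ hn') (hw _ _)
      have : 0 < cntS u (u ⟨0, hn⟩) := Finset.card_pos.2 ⟨⟨0, hn⟩, by simp⟩
      exact_mod_cast this
  have hexp : Real.exp ((n : ℝ) * ∑ x' : X, empDist x x' * Real.log (S x')) = ∏ l, S (x l) := by
    rw [prod_seq_eq, Finset.mul_sum, Real.exp_sum]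
    refine Finset.prod_congr rfl fun a _ => ?_
    rw [hE, ← mul_assoc, mul_div_cancel₀ _ hn'.ne', Real.exp_nat_mul, Real.exp_log (hSpos a)]
  change _ ≤ _ * Real.exp ((n : ℝ) * ∑ x' : X, empDist x x' * Real.log (S x'))
  rw [hexp]
  have hTpos : (0 : ℝ) < T.card := by
    have : 0 < T.card := Finset.card_pos.2 ⟨u, by simp [hTdef]⟩
    exact_mod_cast this
  set q : ℝ := ∏ a, (cntS u a : ℝ) ^ cntS u a with hq
  have hqpos : 0 < q := by
    refine Finset.prod_pos fun a _ => ?_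
    rcases Nat.eq_zero_or_pos (cntS u a) with h | h
    · simp [h]
    · positivity
  have hl' : (n : ℝ) ^ n ≤ ((n : ℝ) + 1) ^ Fintype.card X * (T.card * q) := by
    rw [hq]; exact_mod_cast hl
  have hP : 0 < ∏ l, S (x l) := Finset.prod_pos fun l _ => hSpos _
  have hsum : q * ∑ xb ∈ T, ∏ l, w (x l) (xb l) ≤ (n : ℝ) ^ n * ∏ l, S (x l) := by
    have e1 : q * ∑ xb ∈ T, ∏ l, w (x l) (xb l)
        = ∑ xb ∈ T, ∏ l, ((cntS u (xb l) : ℝ) * w (x l) (xb l)) := by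
      rw [Finset.mul_sum]
      refine Finset.sum_congr rfl fun v hv => ?_
      rw [Finset.prod_mul_distrib, prod_seq_eq (fun a => (cntS u a : ℝ)) v,
        (Finset.mem_filter.1 hv).2]
    have e2 : (n : ℝ) ^ n * ∏ l, S (x l)
        = ∑ v : Fin n → X, ∏ l, ((cntS u (v l) : ℝ) * w (x l) (v l)) := by
      rw [← Fintype.prod_sum (fun l b => (cntS u b : ℝ) * w (x l) b)]
      have : (n : ℝ) ^ n = ∏ _l : Fin n, (n : ℝ) := by simp
      rw [this, ← Finset.prod_mul_distrib]
      refine Finset.prod_congr rfl fun l _ => ?_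
      rw [hS, Finset.mul_sum]
      refine Finset.sum_congr rfl fun b _ => ?_
      rw [hE, ← mul_assoc, mul_div_cancel₀ _ hn'.ne']
    rw [e1, e2]
    refine Finset.sum_le_sum_of_subset_of_nonneg (Finset.subset_univ _) fun v _ _ => ?_
    exact Finset.prod_nonneg fun l _ => mul_nonneg (by positivity) (hw _ _).le
  rw [one_div, inv_mul_le_iff₀ hTpos]
  refine le_of_mul_le_mul_left ?_ hqpos
  refine hsum.trans ((mul_le_mul_of_nonneg_right hl' hP.le).trans (le_of_eq ?_))
  ring

/-- constant-composition expectation bound, cf. Poltyrev's lemma: for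
`x ∈ T^n(Q_a)` and `X̄` uniform on `T^n(Q_b)`,
`𝔼[∏_l e^{-d_B(x_l, X̄_l)/ρ}] ≤ (n+1)^{|𝒳|} exp(n Σ_{x'} Q_a(x') log Σ_{x̄} Q_b(x̄) e^{-d_B(x', x̄)/ρ})`. -/
theorem stmt15 {X Y : Type} [Fintype X] [Fintype Y]
    (W : X → Y → ℝ) (hW : IsDMC W) (n : ℕ)
    (Qa Qb : X → ℝ) (x : Fin n → X) (hx : empDist x = Qa)
    (hQb : IsType n Qb) (ρ : ℝ) (hρ : 0 < ρ) :
    (1 / ((typeClass n Qb).card : ℝ)) *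
        ∑ xb ∈ typeClass n Qb, ∏ l, Real.exp (-dB W (x l) (xb l) / ρ)
      ≤ ((n : ℝ) + 1) ^ Fintype.card X *
        Real.exp ((n : ℝ) * ∑ x' : X, Qa x' *
          Real.log (∑ xbar : X, Qb xbar * Real.exp (-dB W x' xbar / ρ))) := by
  obtain ⟨u, rfl⟩ := hQb
  subst hx
  rcases Nat.eq_zero_or_pos n with h0 | hn
  · subst h0
    have : (typeClass 0 (empDist u)).card ≤ 1 := by
      refine (Finset.card_le_univ _).trans (by simp)
    have h1 : ((typeClass 0 (empDist u)).card : ℝ) * ((typeClass 0 (empDist u)).card : ℝ)⁻¹ ≤ 1 :=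
      mul_inv_le_one
    simpa [mul_comm] using h1
  · exact main_bound hn (fun a b => Real.exp (-dB W a b / ρ)) (fun _ _ => Real.exp_pos _) x u

end
end

section
/- For every probability distribution Q on 𝒳 and every ρ ≥ 1, the constant-composition expurgated dual function dominates the weak one: E_x(Q, ρ) ≥ E′_x(Q, ρ). -/
open scoped Classical BigOperators

noncomputable section

theorem aux_kkt {X : Type} [Fintype X] (B : X → X → ℝ) (hB : ∀ x x', 0 < B x x')
    (Q : X → ℝ) (hQ : IsProbDist Q) :
    ∃ P : X → ℝ, IsProbDist P ∧ (∀ x, 0 < ∑ x', P x' * B x x') ∧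
      (∀ P', IsProbDist P' → ∑ x, Q x * Real.log (∑ x', P' x' * B x x') ≤
        ∑ x, Q x * Real.log (∑ x', P x' * B x x')) ∧
      ∀ z, ∑ x, Q x * (B x z / ∑ x', P x' * B x x') ≤ 1 := by
  have hpos : ∀ P : X → ℝ, IsProbDist P → ∀ x, 0 < ∑ x', P x' * B x x' := by
    intro P hP x
    have h0 : ∀ x' ∈ Finset.univ, 0 ≤ P x' * B x x' := fun x' _ =>
      mul_nonneg (hP.1 x') (hB x x').le
    refine lt_of_le_of_ne (Finset.sum_nonneg h0) fun h => ?_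
    have h1 := (Finset.sum_eq_zero_iff_of_nonneg h0).1 h.symm
    have h2 : ∑ x', P x' = 0 := Finset.sum_eq_zero fun x' hx' =>
      (mul_eq_zero.1 (h1 x' hx')).resolve_right (hB x x').ne'
    rw [hP.2] at h2
    exact one_ne_zero h2
  have hcont : ContinuousOn (fun P : X → ℝ => ∑ x, Q x * Real.log (∑ x', P x' * B x x'))
      (stdSimplex ℝ X) := by
    refine continuousOn_finsetSum _ fun x _ => ?_
    refine continuousOn_const.mul (ContinuousOn.log (by fun_prop) ?_)
    intro P hP
    exact (hpos P hP x).ne'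
  obtain ⟨P, hP, hmax⟩ := (isCompact_stdSimplex ℝ X).exists_isMaxOn ⟨Q, hQ⟩ hcont
  have hP' : IsProbDist P := hP
  refine ⟨P, hP, hpos P hP, fun P' h => hmax h, fun z => ?_⟩
  set S : X → ℝ := fun x => ∑ x', P x' * B x x' with hS
  have hSp : ∀ x, 0 < S x := hpos P hP
  set r : X → ℝ := fun x => B x z / S x with hr
  have hrp : ∀ x, 0 < r x := fun x => div_pos (hB x z) (hSp x)
  have key : ∀ t : ℝ, 0 < t → t < 1 → ∑ x, Q x * ((r x - 1) / (1 + t * (r x - 1))) ≤ 0 := by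
    intro t ht ht1
    have hPt : IsProbDist (fun x => (1 - t) * P x + t * (if x = z then 1 else 0)) := by
      constructor
      · intro a
        have := hP'.1 a
        have h1 : 0 ≤ 1 - t := by linarith
        beta_reduce
        split_ifs <;> nlinarith [mul_nonneg h1 this]
      · rw [Finset.sum_add_distrib, ← Finset.mul_sum, ← Finset.mul_sum, hP'.2]
        simp
    have hm := hmax hPt
    simp only [Set.mem_ofPred_eq] at hm
    have e : ∀ x, ∑ x', ((1 - t) * P x' + t * (if x' = z then 1 else 0)) * B x x'
        = S x * (1 + t * (r x - 1)) := by
      intro x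
      have h1 : ∑ x', ((1 - t) * P x' + t * (if x' = z then 1 else 0)) * B x x'
          = (1 - t) * S x + t * B x z := by
        simp only [add_mul, Finset.sum_add_distrib, hS, Finset.mul_sum]
        congr 1
        · exact Finset.sum_congr rfl fun _ _ => by ring
        · simp
      rw [h1]
      have : S x * r x = B x z := by
        simp only [hr]; field_simp [(hSp x).ne']
      linear_combination -t * this
    simp only [e] at hm
    have hu : ∀ x, 0 < 1 + t * (r x - 1) := fun x => by nlinarith [mul_pos ht (hrp x)]
    have h2 : ∑ x, Q x * (t * ((r x - 1) / (1 + t * (r x - 1)))) ≤ 0 := by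
      have h3 : ∀ x, Q x * (t * ((r x - 1) / (1 + t * (r x - 1)))) ≤
          Q x * Real.log (S x * (1 + t * (r x - 1))) - Q x * Real.log (S x) := by
        intro x
        rw [← mul_sub, Real.log_mul (hSp x).ne' (hu x).ne', add_sub_cancel_left]
        refine mul_le_mul_of_nonneg_left ?_ (hQ.1 x)
        have := Real.one_sub_inv_le_log_of_pos (hu x)
        refine le_trans (le_of_eq ?_) this
        have := (hu x).ne'
        field_simp
        ring
      have h4 := Finset.sum_le_sum fun x (_ : x ∈ Finset.univ) => h3 x
      rw [Finset.sum_sub_distrib] at h4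
      linarith
    have h5 : ∑ x, Q x * (t * ((r x - 1) / (1 + t * (r x - 1)))) =
        t * ∑ x, Q x * ((r x - 1) / (1 + t * (r x - 1))) := by
      rw [Finset.mul_sum]
      exact Finset.sum_congr rfl fun _ _ => by ring
    rw [h5] at h2
    by_contra hc
    push Not at hc
    linarith [mul_pos ht hc]
  have hc : ContinuousAt (fun t : ℝ => ∑ x, Q x * ((r x - 1) / (1 + t * (r x - 1)))) 0 := by
    refine tendsto_finsetSum _ fun x _ => ?_
    refine ContinuousAt.mul continuousAt_const (ContinuousAt.div continuousAt_const
      (by fun_prop) (by simp))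
  have hl := hc.tendsto.mono_left (nhdsWithin_le_nhds (s := Set.Ioi (0:ℝ)))
  have h0 := le_of_tendsto hl (b := 0) (by
    filter_upwards [Ioo_mem_nhdsGT (show (0:ℝ) < 1 by norm_num)] with t ht
    exact key t ht.1 ht.2)
  simp only [zero_mul, add_zero, div_one] at h0
  simp only [mul_sub, mul_one, Finset.sum_sub_distrib, hQ.2] at h0
  linarith

theorem aux_jensen {X : Type} [Fintype X] (B : X → X → ℝ) (hB : ∀ x x', 0 < B x x')
    (Q : X → ℝ) (hQ : IsProbDist Q) :
    ∃ c : ℝ, ∀ b : X → ℝ,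
      c ≤ ∑ x, Q x * Real.log (∑ x', Q x' * (B x x' * Real.exp (b x' - b x))) := by
  refine ⟨∑ x, Q x * ∑ x', Q x' * Real.log (B x x'), fun b => ?_⟩
  have h : ∀ x, Q x * (∑ x', Q x' * Real.log (B x x') + (∑ x', Q x' * b x') - b x) ≤
      Q x * Real.log (∑ x', Q x' * (B x x' * Real.exp (b x' - b x))) := by
    intro x
    refine mul_le_mul_of_nonneg_left ?_ (hQ.1 x)
    have hj := convexOn_exp.map_sum_le (t := Finset.univ) (w := Q)
      (p := fun x' => Real.log (B x x') + (b x' - b x)) (fun i _ => hQ.1 i) hQ.2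
      (fun _ _ => Set.mem_univ _)
    simp only [smul_eq_mul, Real.exp_add, Real.exp_log (hB _ _)] at hj
    have := Real.log_le_log (Real.exp_pos _) hj
    rw [Real.log_exp] at this
    refine le_trans (le_of_eq ?_) this
    simp only [mul_add, mul_sub, Finset.sum_add_distrib, Finset.sum_sub_distrib,
      ← Finset.sum_mul, hQ.2]
    ring
  have h2 := Finset.sum_le_sum fun x (_ : x ∈ Finset.univ) => h x
  refine le_trans (le_of_eq ?_) h2
  simp only [mul_add, mul_sub, Finset.sum_add_distrib, Finset.sum_sub_distrib,
    ← Finset.sum_mul, hQ.2]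
  ring

/-- the constant-composition expurgated dual function dominates the
weak one: `E_x(Q, ρ) ≥ E'_x(Q, ρ)` for every distribution `Q` and every `ρ ≥ 1`. -/
theorem stmt16 {X Y : Type} [Fintype X] [Fintype Y]
    (W : X → Y → ℝ) (hW : IsDMC W)
    (Q : X → ℝ) (hQ : IsProbDist Q) (ρ : ℝ) (hρ : 1 ≤ ρ) :
    Ex' W Q ρ ≤ Ex W Q ρ := by
  have hρ0 : 0 < ρ := by linarith
  set B : X → X → ℝ := fun x x' => Real.exp (-dB W x x' / ρ) with hBdef
  have hB : ∀ x x', 0 < B x x' := fun _ _ => Real.exp_pos _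
  have hsymm : ∀ x x', B x x' = B x' x := by
    intro x x'
    simp only [hBdef, dB, mul_comm]
  have hpow : ∀ (a : X → ℝ) x x', (Real.exp (-dB W x x') * Real.exp (a x' - a x)) ^ (1 / ρ)
      = B x x' * Real.exp (a x' / ρ - a x / ρ) := by
    intro a x x'
    simp only [hBdef]
    rw [← Real.exp_add, ← Real.exp_add, ← Real.exp_mul]
    congr 1
    ring
  obtain ⟨P, hP, hSp, hmax, hkkt⟩ := aux_kkt B hB Q hQ
  have h1 : Ex' W Q ρ ≤ -ρ * ∑ x, Q x * Real.log (∑ x', P x' * B x x') := by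
    refine csInf_le ⟨-ρ * ∑ x, Q x * Real.log (∑ x', P x' * B x x'), ?_⟩ ⟨P, hP, rfl⟩
    rintro z ⟨P', hP', rfl⟩
    exact mul_le_mul_of_nonpos_left (hmax P' hP') (by linarith)
  set S : X → ℝ := fun x => ∑ x', P x' * B x x' with hS
  have h2 : -ρ * ∑ x, Q x * Real.log (∑ x', Q x' *
      (B x x' * Real.exp (-Real.log (S x') - -Real.log (S x)))) ≤ Ex W Q ρ := by
    refine le_csSup ?_ ⟨fun x => -ρ * Real.log (S x), ?_⟩
    · obtain ⟨c, hc⟩ := aux_jensen B hB Q hQ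
      refine ⟨-ρ * c, ?_⟩
      rintro z ⟨a, rfl⟩
      simp only [hpow]
      exact mul_le_mul_of_nonpos_left (hc fun x => a x / ρ) (by linarith)
    · have hp := hpow (fun x => -ρ * Real.log (S x))
      beta_reduce at hp
      simp only [hp]
      have : ∀ x, -ρ * Real.log (S x) / ρ = -Real.log (S x) := fun x => by
        field_simp
      simp only [this]
  refine h1.trans (le_trans ?_ h2)
  refine mul_le_mul_of_nonpos_left (Finset.sum_le_sum fun x _ => ?_) (by linarith)
  refine mul_le_mul_of_nonneg_left ?_ (hQ.1 x)
  have e : ∑ x', Q x' * (B x x' * Real.exp (-Real.log (S x') - -Real.log (S x))) =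
      S x * ∑ x', Q x' * (B x' x / S x') := by
    rw [Finset.mul_sum]
    refine Finset.sum_congr rfl fun x' _ => ?_
    rw [sub_neg_eq_add, Real.exp_add, Real.exp_neg, Real.exp_log (hSp x'), Real.exp_log (hSp x),
      hsymm x x']
    ring
  have hpos : 0 < ∑ x', Q x' * (B x' x / S x') := by
    have h0 : ∀ x' ∈ Finset.univ, 0 ≤ Q x' * (B x' x / S x') := fun x' _ =>
      mul_nonneg (hQ.1 x') (div_pos (hB x' x) (hSp x')).le
    refine lt_of_le_of_ne (Finset.sum_nonneg h0) fun h => ?_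
    have h1 := (Finset.sum_eq_zero_iff_of_nonneg h0).1 h.symm
    have h2 : ∑ x', Q x' = 0 := Finset.sum_eq_zero fun x' hx' =>
      (mul_eq_zero.1 (h1 x' hx')).resolve_right (div_pos (hB x' x) (hSp x')).ne'
    rw [hQ.2] at h2
    exact one_ne_zero h2
  rw [e]
  exact Real.log_le_log (mul_pos (hSp x) hpos)
    (mul_le_of_le_one_right (hSp x).le (hkkt x))

end
end

section
/- Fix a codebook assigning a codeword x_v ∈ 𝒳^n to every v ∈ 𝒱^k, and define the decoding metric q(v, x, y) := W^n(y|x) · exp(2k·D(P̂_v‖P_V)). Then for every pair of source types Pᵢ, Pⱼ ∈ 𝒫_k(𝒱) and every v ∈ T^k(Pᵢ): Σ_{y∈𝒴^n} W^n(y|x_v) · 1{ ∃ v̄ ∈ T^k(Pⱼ) with q(v̄, x_{v̄}, y) ≥ q(v, x_v, y) } ≤ exp( k·( D(Pⱼ‖P_V) − D(Pᵢ‖P_V) ) ) · Σ_{v̄ ∈ T^k(Pⱼ)} ∏_{l=1}^{n} Σ_{y∈𝒴} √( W(y | (x_v)_l) · W(y | (x_{v̄})_l) ). -/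
open scoped Classical BigOperators

noncomputable section

/-- pairwise error bound for the tilted decoding metric
`q(v, x, y) = W^n(y|x) exp(2k D(P̂_v‖P_V))`: for source types `Pᵢ, Pⱼ` and
`v ∈ T^k(Pᵢ)`, the probability that some `v̄ ∈ T^k(Pⱼ)` has a metric at least as high as
`v` is bounded by the Bhattacharyya sum times `exp(k(D(Pⱼ‖P_V) - D(Pᵢ‖P_V)))`. -/
theorem stmt17 {V X Y : Type} [Fintype V] [Fintype X] [Fintype Y]
    (PV : V → ℝ) (hPV : IsProbDist PV) (W : X → Y → ℝ) (hW : IsDMC W)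
    (k n : ℕ) (enc : (Fin k → V) → Fin n → X)
    (Pi Pj : V → ℝ) (hPi : IsType k Pi) (hPj : IsType k Pj)
    (v : Fin k → V) (hv : empDist v = Pi) :
    ∑ y ∈ Finset.univ.filter (fun y : Fin n → Y =>
        ∃ vb : Fin k → V, empDist vb = Pj ∧
          Wn W (enc v) y * Real.exp (2 * (k : ℝ) * KL (empDist v) PV) ≤
          Wn W (enc vb) y * Real.exp (2 * (k : ℝ) * KL (empDist vb) PV)),
        Wn W (enc v) y
      ≤ Real.exp ((k : ℝ) * (KL Pj PV - KL Pi PV)) *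
        ∑ vb ∈ typeClass k Pj, ∏ l,
          ∑ y : Y, Real.sqrt (W (enc v l) y * W (enc vb l) y) := by
  have hn : ∀ (x : Fin n → X) (y : Fin n → Y), 0 ≤ Wn W x y := fun x y =>
    Finset.prod_nonneg fun l _ => hW.1 _ _
  have hprod : ∀ vb : Fin k → V, (∏ l, ∑ y : Y, Real.sqrt (W (enc v l) y * W (enc vb l) y))
      = ∑ y : Fin n → Y, Real.sqrt (Wn W (enc v) y * Wn W (enc vb) y) := by
    intro vb
    rw [Finset.prod_univ_sum, Fintype.piFinset_univ]
    refine Finset.sum_congr rfl fun y _ => ?_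
    unfold Wn
    rw [← Finset.prod_mul_distrib, Real.sqrt_prod]
    intro l _
    exact mul_nonneg (hW.1 _ _) (hW.1 _ _)
  have key : ∀ a b A B : ℝ, 0 ≤ a → 0 ≤ b →
      a * Real.exp (2 * (k : ℝ) * A) ≤ b * Real.exp (2 * (k : ℝ) * B) →
      a ≤ Real.exp ((k : ℝ) * (B - A)) * Real.sqrt (a * b) := by
    intro a b A B ha hb h
    have e : Real.exp (2 * (k : ℝ) * B)
        = Real.exp ((k : ℝ) * (B - A)) ^ 2 * Real.exp (2 * (k : ℝ) * A) := by
      rw [← Real.exp_nat_mul, ← Real.exp_add]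
      congr 1
      push_cast
      ring
    rw [e, ← mul_assoc] at h
    have h2 : a ≤ b * Real.exp ((k : ℝ) * (B - A)) ^ 2 :=
      le_of_mul_le_mul_right h (Real.exp_pos _)
    refine abs_le_of_sq_le_sq' ?_ (by positivity) |>.2
    rw [mul_pow, Real.sq_sqrt (mul_nonneg ha hb)]
    nlinarith [mul_le_mul_of_nonneg_left h2 ha]
  simp_rw [hprod]
  rw [Finset.sum_comm, Finset.mul_sum]
  refine le_trans (Finset.sum_le_sum ?_) (Finset.sum_le_sum_of_subset_of_nonneg
    (Finset.filter_subset _ _) ?_)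
  · intro y hy
    obtain ⟨vb, hvb, h⟩ := (Finset.mem_filter.mp hy).2
    refine (key _ _ _ _ (hn _ _) (hn _ _) h).trans ?_
    rw [hv, hvb]
    refine mul_le_mul_of_nonneg_left ?_ (Real.exp_pos _).le
    exact Finset.single_le_sum
      (f := fun vb => Real.sqrt (Wn W (enc v) y * Wn W (enc vb) y))
      (fun _ _ => Real.sqrt_nonneg _)
      (by simp [typeClass, hvb])
  · intro y _ _
    exact mul_nonneg (Real.exp_pos _).le (Finset.sum_nonneg fun _ _ => Real.sqrt_nonneg _)

end
end
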